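/- Let D ⊆ ℝⁿ be open, let E ⊆ D be closed in D and satisfy assumption (E), let ℓ be a local action on D, and let b : D → ℝⁿ be a drift of ℓ with globally defined flow ψ. Let M ⊆ D be an admissible manifold of b and let x ∈ ψ(M,ℝ) ∩ E, where ψ(M,ℝ) := {ψ(m,s) : m ∈ M, s ∈ ℝ}. Then x has strong local minimizers. -/

import Mathlib

open MeasureTheory Set Filter
open scoped RealInnerProductSpace

abbrev Euc (n : ℕ) := EuclideanSpace ℝ (Fin n)

/-- `φ` is absolutely continuous on `[0,1]` with derivative `φ'`. -/
def GeoAC {n : ℕ} (φ φ' : ℝ → Euc n) : Prop :=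
  MeasureTheory.IntegrableOn φ' (Set.Icc 0 1) ∧
    ∀ t ∈ Set.Icc (0:ℝ) 1, φ t = φ 0 + ∫ s in (0:ℝ)..t, φ' s

/-- The geometric action `S(φ) = ∫₀¹ ℓ(φ,φ') dα`. -/
noncomputable def geoAction {n : ℕ} (ℓ : Euc n → Euc n → ℝ) (φ φ' : ℝ → Euc n) : ℝ :=
  ∫ α in (0:ℝ)..1, ℓ (φ α) (φ' α)

/-- The length `∫₀¹ |φ'| dα` of an absolutely continuous curve. -/
noncomputable def geoLen {n : ℕ} (φ' : ℝ → Euc n) : ℝ :=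
  ∫ α in (0:ℝ)..1, ‖φ' α‖

/-- The set of actions of absolutely continuous curves in `Eset` from `A₁` to `A₂`. -/
def geoActSet {n : ℕ} (ℓ : Euc n → Euc n → ℝ) (Eset A₁ A₂ : Set (Euc n)) : Set ℝ :=
  {s | ∃ φ φ' : ℝ → Euc n, GeoAC φ φ' ∧ (∀ t ∈ Set.Icc (0:ℝ) 1, φ t ∈ Eset) ∧
    φ 0 ∈ A₁ ∧ φ 1 ∈ A₂ ∧ s = geoAction ℓ φ φ'}

/-- Assumption (E): nearby points of `Eset` can be joined by short curves in `Eset`. -/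
def GeoAssumpE {n : ℕ} (Eset : Set (Euc n)) : Prop :=
  ∀ x ∈ Eset, ∀ ν > (0:ℝ), ∃ r > (0:ℝ), ∀ w ∈ Metric.closedBall x r ∩ Eset,
    ∃ φ φ' : ℝ → Euc n, GeoAC φ φ' ∧ (∀ t ∈ Set.Icc (0:ℝ) 1, φ t ∈ Eset) ∧
      φ 0 = x ∧ φ 1 = w ∧ geoLen φ' ≤ ν

/-- A point `x ∈ Eset` has strong local minimizers. -/
def GeoHasStrongLocalMin {n : ℕ} (ℓ : Euc n → Euc n → ℝ) (Eset : Set (Euc n))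
    (x : Euc n) : Prop :=
  ∃ r > (0:ℝ), ∃ η > (0:ℝ), ∃ K : Set (Euc n), IsCompact K ∧ K ⊆ Eset ∧
    ∀ x₁ ∈ Metric.closedBall x r ∩ Eset, ∀ x₂ ∈ Metric.closedBall x r ∩ Eset,
      ∃ φ φ' : ℝ → Euc n, GeoAC φ φ' ∧ (∀ t ∈ Set.Icc (0:ℝ) 1, φ t ∈ K) ∧
        φ 0 = x₁ ∧ φ 1 = x₂ ∧ geoLen φ' ≤ η ∧
        geoAction ℓ φ φ' = sInf (geoActSet ℓ Eset {x₁} {x₂})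

/-- `ψ` is a globally defined flow of the vector field `b` on `D`. -/
def GeoIsFlow {n : ℕ} (D : Set (Euc n)) (b : Euc n → Euc n)
    (ψ : Euc n → ℝ → Euc n) : Prop :=
  (∀ x ∈ D, ψ x 0 = x) ∧ (∀ x ∈ D, ∀ t : ℝ, ψ x t ∈ D) ∧
    (∀ x ∈ D, ∀ t : ℝ, HasDerivAt (ψ x) (b (ψ x t)) t)

/-- `M` is an admissible manifold of `b`. -/
def GeoIsAdmissible {n : ℕ} (D : Set (Euc n)) (b : Euc n → Euc n)
    (M : Set (Euc n)) : Prop :=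
  ∃ f : Euc n → ℝ, ContinuousOn f D ∧ M = {w ∈ D | f w = 0} ∧ IsCompact M ∧
    (∃ U : Set (Euc n), IsOpen U ∧ M ⊆ U ∧ U ⊆ D ∧ ContDiffOn ℝ 1 f U) ∧
    ∀ x ∈ M, 0 < ⟪gradient f x, b x⟫

open scoped NNReal Topology

section LipschitzCurves

variable {n : ℕ}

lemma integrable_deriv_of_lipschitzWith {θ : ℝ → Euc n} {η : ℝ≥0} (hθ : LipschitzWith η θ)
    (a c : ℝ) : IntervalIntegrable (deriv θ) volume a c := by
  refine (intervalIntegrable_const (c := (η : ℝ))).mono_fun'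
    (stronglyMeasurable_deriv θ).aestronglyMeasurable ?_
  exact Eventually.of_forall fun t => norm_deriv_le_of_lipschitz hθ

lemma GeoAC.of_lipschitzWith {θ : ℝ → Euc n} {η : ℝ≥0} (hθ : LipschitzWith η θ) :
    GeoAC θ (deriv θ) := by
  have hint : IntervalIntegrable (deriv θ) volume 0 1 := integrable_deriv_of_lipschitzWith hθ 0 1
  refine ⟨(intervalIntegrable_iff_integrableOn_Icc_of_le zero_le_one).1 hint, ?_⟩
  set F : ℝ → Euc n := fun t => ∫ s in (0:ℝ)..t, deriv θ s with hF
  have hFlip : LipschitzWith η F := by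
    refine LipschitzWith.of_dist_le_mul fun u v => ?_
    rw [dist_eq_norm, dist_eq_norm, Real.norm_eq_abs, hF]
    simp only
    rw [intervalIntegral.integral_interval_sub_left
      (integrable_deriv_of_lipschitzWith hθ _ _) (integrable_deriv_of_lipschitzWith hθ _ _)]
    exact intervalIntegral.norm_integral_le_of_norm_le_const
      fun t _ => norm_deriv_le_of_lipschitz hθ
  have hac : AbsolutelyContinuousOnInterval (fun t => θ t - F t) 0 1 :=
    ((hθ.lipschitzOnWith (s := uIcc 0 1)).absolutelyContinuousOnInterval).sub
      ((hFlip.lipschitzOnWith (s := uIcc 0 1)).absolutelyContinuousOnInterval)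
  obtain ⟨C, hC⟩ := hac.const_of_ae_hasDerivAt_zero (by
    filter_upwards [hθ.ae_differentiableAt_real, hint.ae_hasDerivAt_integral] with t h1 h2 h3
    have h4 := h1.hasDerivAt.sub (h2 h3 0 (by simp))
    rw [sub_self] at h4
    exact h4)
  intro t ht
  have h0 := hC 0 (by simp)
  have h1 := hC t (by rwa [uIcc_of_le zero_le_one])
  have hF0 : F 0 = 0 := by simp [hF]
  rw [hF0, sub_zero] at h0
  rw [h0, ← h1]; simp [hF]

lemma geoLen_deriv_le_of_lipschitzWith {θ : ℝ → Euc n} {η : ℝ≥0} (hθ : LipschitzWith η θ) :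
    geoLen (deriv θ) ≤ η := by
  have := intervalIntegral.integral_mono_on (zero_le_one (α := ℝ))
    (integrable_deriv_of_lipschitzWith hθ 0 1).norm (intervalIntegrable_const (c := (η : ℝ)))
    (fun t _ => norm_deriv_le_of_lipschitz hθ)
  simpa [geoLen] using this

lemma GeoAC.intervalIntegrable {φ φ' : ℝ → Euc n} (h : GeoAC φ φ') {a c : ℝ}
    (ha : a ∈ Icc (0:ℝ) 1) (hc : c ∈ Icc (0:ℝ) 1) : IntervalIntegrable φ' volume a c := by
  rw [intervalIntegrable_iff]
  exact h.1.mono_set (uIoc_subset_uIcc.trans (uIcc_subset_Icc ha hc))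

lemma GeoAC.sub_eq {φ φ' : ℝ → Euc n} (h : GeoAC φ φ') {a c : ℝ}
    (ha : a ∈ Icc (0:ℝ) 1) (hc : c ∈ Icc (0:ℝ) 1) : φ c - φ a = ∫ s in a..c, φ' s := by
  have h0 : (0:ℝ) ∈ Icc (0:ℝ) 1 := by simp
  rw [h.2 c hc, h.2 a ha, add_sub_add_left_eq_sub]
  exact intervalIntegral.integral_interval_sub_left (h.intervalIntegrable h0 hc)
    (h.intervalIntegrable h0 ha)

lemma GeoAC.norm_sub_le {φ φ' : ℝ → Euc n} (h : GeoAC φ φ') {a c : ℝ}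
    (ha : a ∈ Icc (0:ℝ) 1) (hc : c ∈ Icc (0:ℝ) 1) (hac : a ≤ c) :
    ‖φ c - φ a‖ ≤ ∫ s in a..c, ‖φ' s‖ := by
  rw [h.sub_eq ha hc]
  exact intervalIntegral.norm_integral_le_integral_norm hac

lemma GeoAC.continuousOn {φ φ' : ℝ → Euc n} (h : GeoAC φ φ') : ContinuousOn φ (Icc 0 1) := by
  have h0 : (0:ℝ) ∈ Icc (0:ℝ) 1 := by simp
  have h1 : (1:ℝ) ∈ Icc (0:ℝ) 1 := by simp
  have := (intervalIntegral.continuousOn_primitive_interval (μ := volume) (f := φ')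
    (a := 0) (b := 1) (by rw [uIcc_of_le zero_le_one]; exact h.1))
  rw [uIcc_of_le zero_le_one] at this
  exact (continuousOn_const.add this).congr h.2

lemma GeoAC.ae_hasDerivAt {φ φ' : ℝ → Euc n} (h : GeoAC φ φ') :
    ∀ᵐ t, t ∈ Ioo (0:ℝ) 1 → HasDerivAt φ (φ' t) t := by
  have h0 : (0:ℝ) ∈ Icc (0:ℝ) 1 := by simp
  have h1 : (1:ℝ) ∈ Icc (0:ℝ) 1 := by simp
  filter_upwards [(h.intervalIntegrable h0 h1).ae_hasDerivAt_integral] with t ht hmem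
  have h2 := (ht (by rw [uIcc_of_le zero_le_one]; exact Ioo_subset_Icc_self hmem) 0
    (by simp)).const_add (φ 0)
  refine h2.congr_of_eventuallyEq ?_
  filter_upwards [Ioo_mem_nhds hmem.1 hmem.2] with s hs
  exact h.2 s (Ioo_subset_Icc_self hs)

/-- A monotone change of parameter along which an absolutely continuous curve
becomes Lipschitz. -/
lemma GeoAC.exists_reparametrization {φ φ' : ℝ → Euc n} (h : GeoAC φ φ') {η : ℝ}
    (hη : geoLen φ' < η) :
    ∃ β : ℝ → ℝ, Monotone β ∧ (∀ u, β u ∈ Icc (0:ℝ) 1) ∧ β 0 = 0 ∧ β 1 = 1 ∧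
      ∀ u v, u ≤ v → ∫ s in (β u)..(β v), ‖φ' s‖ ≤ η * (v - u) := by
  have h0 : (0:ℝ) ∈ Icc (0:ℝ) 1 := by simp
  have h1 : (1:ℝ) ∈ Icc (0:ℝ) 1 := by simp
  have hlen : 0 ≤ geoLen φ' :=
    intervalIntegral.integral_nonneg zero_le_one fun _ _ => norm_nonneg _
  set ε := η - geoLen φ' with hε
  have hεpos : 0 < ε := by linarith
  set α : ℝ → ℝ := fun t => ε * t + ∫ s in (0:ℝ)..t, ‖φ' s‖ with hα
  have hsub : ∀ a ∈ Icc (0:ℝ) 1, ∀ c ∈ Icc (0:ℝ) 1,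
      α c - α a = ε * (c - a) + ∫ s in a..c, ‖φ' s‖ := by
    intro a ha c hc
    rw [← intervalIntegral.integral_interval_sub_left (h.intervalIntegrable h0 hc).norm
      (h.intervalIntegrable h0 ha).norm]
    simp only [hα]; ring
  have hnn : ∀ a c : ℝ, a ≤ c → 0 ≤ ∫ s in a..c, ‖φ' s‖ := fun a c hac =>
    intervalIntegral.integral_nonneg hac fun _ _ => norm_nonneg _
  have hα0 : α 0 = 0 := by simp [hα]
  have hα1 : α 1 = η := by
    have : (∫ s in (0:ℝ)..1, ‖φ' s‖) = geoLen φ' := rfl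
    simp only [hα, this, hε]; ring
  have hcont : ContinuousOn α (Icc 0 1) := by
    have := (intervalIntegral.continuousOn_primitive_interval (μ := volume)
      (f := fun s => ‖φ' s‖) (a := 0) (b := 1)
      (by rw [uIcc_of_le zero_le_one]; exact h.1.norm))
    rw [uIcc_of_le zero_le_one] at this
    exact (continuousOn_const.mul continuousOn_id).add this
  have hinj : ∀ a ∈ Icc (0:ℝ) 1, ∀ c ∈ Icc (0:ℝ) 1, α a ≤ α c → a ≤ c := by
    intro a ha c hc hle
    by_contra! hlt
    have h2 := hsub c hc a ha
    have h3 := hnn c a hlt.le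
    have h4 : 0 < ε * (a - c) := mul_pos hεpos (by linarith)
    linarith
  have hex : ∀ u : ℝ, ∃ t ∈ Icc (0:ℝ) 1, α t = η * max 0 (min u 1) := by
    intro u
    have := intermediate_value_Icc (zero_le_one (α := ℝ)) hcont
    rw [hα0, hα1] at this
    have hp0 : 0 ≤ max 0 (min u 1) := le_max_left _ _
    have hp1 : max 0 (min u 1) ≤ 1 := max_le zero_le_one (min_le_right _ _)
    exact this ⟨by nlinarith, by nlinarith⟩
  choose β hβ hβα using hex
  have hpmono : ∀ u v : ℝ, u ≤ v → max 0 (min u 1) ≤ max 0 (min v 1) := fun u v huv => by gcongr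
  have hmono : Monotone β := fun u v huv => hinj _ (hβ u) _ (hβ v) (by
    rw [hβα, hβα]; have := hpmono u v huv; gcongr; linarith)
  refine ⟨β, hmono, hβ, ?_, ?_, ?_⟩
  · refine le_antisymm (hinj _ (hβ 0) _ h0 ?_) (hβ 0).1
    rw [hβα, hα0]; simp
  · refine le_antisymm (hβ 1).2 (hinj _ h1 _ (hβ 1) ?_)
    rw [hβα, hα1]; simp
  · intro u v huv
    have h2 := hsub _ (hβ u) _ (hβ v)
    rw [hβα, hβα] at h2
    have h3 : 0 ≤ ε * (β v - β u) := mul_nonneg hεpos.le (by linarith [hmono huv])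
    have h4 : max 0 (min v 1) - max 0 (min u 1) ≤ v - u := by
      rcases max_cases 0 (min v 1) with h | h <;> rcases max_cases 0 (min u 1) with h' | h' <;>
      rcases min_cases v 1 with h5 | h5 <;> rcases min_cases u 1 with h6 | h6 <;> linarith
    have h5 := mul_le_mul_of_nonneg_left h4 (by linarith : (0:ℝ) ≤ η)
    linarith

lemma GeoAC.lipschitzWith_reparametrization {φ φ' : ℝ → Euc n} (h : GeoAC φ φ') {η : ℝ≥0}
    {β : ℝ → ℝ} (hmono : Monotone β) (hβ : ∀ u, β u ∈ Icc (0:ℝ) 1)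
    (hlip : ∀ u v, u ≤ v → ∫ s in (β u)..(β v), ‖φ' s‖ ≤ η * (v - u)) :
    LipschitzWith η (fun u => φ (β u)) := by
  refine LipschitzWith.of_dist_le_mul fun u v => ?_
  wlog huv : u ≤ v generalizing u v
  · rw [dist_comm, dist_comm u v]; exact this v u (le_of_not_ge huv)
  rw [dist_comm, dist_comm u v, dist_eq_norm, Real.dist_eq, abs_of_nonneg (sub_nonneg.2 huv)]
  exact (h.norm_sub_le (hβ u) (hβ v) (hmono huv)).trans (hlip u v huv)

end LipschitzCurves
section LowerSemicontinuity

variable {n : ℕ} {D : Set (Euc n)} {ℓ : Euc n → Euc n → ℝ}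

lemma localAction_zero (hℓhom : ∀ x ∈ D, ∀ y : Euc n, ∀ c : ℝ, 0 ≤ c → ℓ x (c • y) = c * ℓ x y)
    {w : Euc n} (hw : w ∈ D) : ℓ w 0 = 0 := by
  simpa using hℓhom w hw 0 0 le_rfl

lemma localAction_eq_norm_mul
    (hℓhom : ∀ x ∈ D, ∀ y : Euc n, ∀ c : ℝ, 0 ≤ c → ℓ x (c • y) = c * ℓ x y)
    {w : Euc n} (hw : w ∈ D) {y : Euc n} (hy : y ≠ 0) :
    ℓ w y = ‖y‖ * ℓ w (‖y‖⁻¹ • y) := by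
  rw [← hℓhom w hw _ _ (norm_nonneg y), smul_smul, mul_inv_cancel₀ (norm_ne_zero_iff.2 hy),
    one_smul]

lemma continuous_localAction
    (hℓcont : ContinuousOn (fun p : Euc n × Euc n => ℓ p.1 p.2) (D ×ˢ univ))
    {w : Euc n} (hw : w ∈ D) : Continuous (ℓ w) :=
  hℓcont.comp_continuous (f := fun y : Euc n => (w, y)) (by fun_prop) fun _ => ⟨hw, mem_univ _⟩

lemma exists_localAction_le
    (hℓcont : ContinuousOn (fun p : Euc n × Euc n => ℓ p.1 p.2) (D ×ˢ univ))
    (hℓhom : ∀ x ∈ D, ∀ y : Euc n, ∀ c : ℝ, 0 ≤ c → ℓ x (c • y) = c * ℓ x y)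
    {K : Set (Euc n)} (hK : IsCompact K) (hKD : K ⊆ D) :
    ∃ B : ℝ, 0 ≤ B ∧ ∀ w ∈ K, ∀ y, ℓ w y ≤ B * ‖y‖ := by
  obtain ⟨B, hB⟩ := ((hK.prod (isCompact_sphere (0 : Euc n) 1)).exists_bound_of_continuousOn
    (hℓcont.mono (prod_mono hKD (subset_univ _))))
  refine ⟨max B 0, le_max_right _ _, fun w hw y => ?_⟩
  rcases eq_or_ne y 0 with rfl | hy
  · simp [localAction_zero hℓhom (hKD hw)]
  · rw [localAction_eq_norm_mul hℓhom (hKD hw) hy, mul_comm]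
    have := hB (w, ‖y‖⁻¹ • y) ⟨hw, by simp [norm_smul, hy]⟩
    gcongr
    exact (le_abs_self _).trans (this.trans (le_max_left _ _))

lemma exists_localAction_le_add
    (hℓcont : ContinuousOn (fun p : Euc n × Euc n => ℓ p.1 p.2) (D ×ˢ univ))
    (hℓhom : ∀ x ∈ D, ∀ y : Euc n, ∀ c : ℝ, 0 ≤ c → ℓ x (c • y) = c * ℓ x y)
    {K : Set (Euc n)} (hK : IsCompact K) (hKD : K ⊆ D) {ε : ℝ} (hε : 0 < ε) :
    ∃ δ > 0, ∀ w ∈ K, ∀ z ∈ K, dist w z < δ → ∀ y, ℓ z y ≤ ℓ w y + ε * ‖y‖ := by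
  have huc := (hK.prod (isCompact_sphere (0 : Euc n) 1)).uniformContinuousOn_of_continuous
    (hℓcont.mono (prod_mono hKD (subset_univ _)))
  obtain ⟨δ, hδ, h⟩ := Metric.uniformContinuousOn_iff.1 huc ε hε
  refine ⟨δ, hδ, fun w hw z hz hwz y => ?_⟩
  rcases eq_or_ne y 0 with rfl | hy
  · simp [localAction_zero hℓhom (hKD hw), localAction_zero hℓhom (hKD hz)]
  · rw [localAction_eq_norm_mul hℓhom (hKD hw) hy, localAction_eq_norm_mul hℓhom (hKD hz) hy]
    have hs : ‖y‖⁻¹ • y ∈ Metric.sphere (0 : Euc n) 1 := by simp [norm_smul, hy]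
    have := h (w, ‖y‖⁻¹ • y) ⟨hw, hs⟩ (z, ‖y‖⁻¹ • y) ⟨hz, hs⟩ (by simpa [Prod.dist_eq] using hwz)
    rw [Real.dist_eq] at this
    have := abs_lt.1 this
    have hn := norm_nonneg y
    simp only at this
    nlinarith [this.1]

/-- Jensen's inequality for sublinear functions. -/
lemma ConvexOn.map_intervalIntegral_le {g : Euc n → ℝ} (hg : ConvexOn ℝ univ g)
    (hgc : Continuous g) (hhom : ∀ y : Euc n, ∀ c : ℝ, 0 ≤ c → g (c • y) = c * g y)
    {v : ℝ → Euc n} {a c : ℝ} (hac : a ≤ c) (hv : IntervalIntegrable v volume a c)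
    (hgv : IntervalIntegrable (fun t => g (v t)) volume a c) :
    g (∫ t in a..c, v t) ≤ ∫ t in a..c, g (v t) := by
  rcases hac.eq_or_lt with rfl | hlt
  · have : g 0 = 0 := by simpa using hhom 0 0 le_rfl
    simp [this]
  have hvol : volume (Ioc a c) ≠ 0 := by simpa using hlt
  have key := hg.map_set_average_le (μ := volume) (t := Ioc a c) (f := v) hgc.continuousOn
    isClosed_univ hvol (by simp) (by simp)
    ((intervalIntegrable_iff_integrableOn_Ioc_of_le hac).1 hv)
    ((intervalIntegrable_iff_integrableOn_Ioc_of_le hac).1 hgv)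
  have hpos : 0 < c - a := by linarith
  rw [setAverage_eq, setAverage_eq, ← intervalIntegral.integral_of_le hac,
    ← intervalIntegral.integral_of_le hac, hhom _ _ (by positivity), smul_eq_mul] at key
  have hr : volume.real (Ioc a c) = c - a := by simp [measureReal_def, hac]
  rw [hr] at key
  exact le_of_mul_le_mul_left key (by positivity)

lemma GeoAC.intervalIntegrable_localAction (hD : IsOpen D)
    (hℓcont : ContinuousOn (fun p : Euc n × Euc n => ℓ p.1 p.2) (D ×ˢ univ))
    (hℓnonneg : ∀ x ∈ D, ∀ y : Euc n, 0 ≤ ℓ x y)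
    (hℓhom : ∀ x ∈ D, ∀ y : Euc n, ∀ c : ℝ, 0 ≤ c → ℓ x (c • y) = c * ℓ x y)
    {φ φ' : ℝ → Euc n} (h : GeoAC φ φ') (hφ : ∀ t ∈ Icc (0:ℝ) 1, φ t ∈ D) {a c : ℝ}
    (ha : a ∈ Icc (0:ℝ) 1) (hc : c ∈ Icc (0:ℝ) 1) :
    IntervalIntegrable (fun t => ℓ (φ t) (φ' t)) volume a c := by
  rw [intervalIntegrable_iff]
  refine IntegrableOn.mono_set ?_ (uIoc_subset_uIcc.trans (uIcc_subset_Icc ha hc))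
  obtain ⟨B, -, hB⟩ := exists_localAction_le hℓcont hℓhom
    (isCompact_Icc.image_of_continuousOn h.continuousOn) (image_subset_iff.2 hφ)
  classical
  have hS : MeasurableSet (D ×ˢ (univ : Set (Euc n))) := (hD.prod isOpen_univ).measurableSet
  have hmeas : Measurable ((D ×ˢ (univ : Set (Euc n))).piecewise
      (fun p : Euc n × Euc n => ℓ p.1 p.2) 0) :=
    hℓcont.measurable_piecewise continuousOn_const hS
  have hpair : AEMeasurable (fun t => (φ t, φ' t)) (volume.restrict (Icc (0:ℝ) 1)) :=
    (h.continuousOn.aemeasurable measurableSet_Icc).prodMk h.1.aemeasurable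
  refine Integrable.mono' (h.1.norm.const_mul B) ?_ ?_
  · refine AEStronglyMeasurable.congr (hmeas.comp_aemeasurable hpair).aestronglyMeasurable ?_
    refine (ae_restrict_iff' measurableSet_Icc).2 (Eventually.of_forall fun t ht => ?_)
    exact piecewise_eq_of_mem _ _ _ ⟨hφ t ht, mem_univ _⟩
  · refine (ae_restrict_iff' measurableSet_Icc).2 (Eventually.of_forall fun t ht => ?_)
    rw [Real.norm_of_nonneg (hℓnonneg _ (hφ t ht) _)]
    exact hB _ (mem_image_of_mem _ ht) _

lemma GeoAC.localAction_sub_le (hD : IsOpen D)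
    (hℓcont : ContinuousOn (fun p : Euc n × Euc n => ℓ p.1 p.2) (D ×ˢ univ))
    (hℓnonneg : ∀ x ∈ D, ∀ y : Euc n, 0 ≤ ℓ x y)
    (hℓhom : ∀ x ∈ D, ∀ y : Euc n, ∀ c : ℝ, 0 ≤ c → ℓ x (c • y) = c * ℓ x y)
    (hℓconv : ∀ x ∈ D, ConvexOn ℝ univ (fun y => ℓ x y))
    {K : Set (Euc n)} (hKD : K ⊆ D) {ε δ : ℝ}
    (hmod : ∀ w ∈ K, ∀ z ∈ K, dist w z < δ → ∀ y, ℓ z y ≤ ℓ w y + ε * ‖y‖)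
    {φ φ' : ℝ → Euc n} (h : GeoAC φ φ') (hφ : ∀ t ∈ Icc (0:ℝ) 1, φ t ∈ K) {a c : ℝ}
    (ha : a ∈ Icc (0:ℝ) 1) (hc : c ∈ Icc (0:ℝ) 1) (hac : a ≤ c)
    (hδ : ∫ t in a..c, ‖φ' t‖ < δ) :
    ℓ (φ a) (φ c - φ a) ≤ (∫ t in a..c, ℓ (φ t) (φ' t)) + ε * ∫ t in a..c, ‖φ' t‖ := by
  have hint := h.intervalIntegrable ha hc
  have hφD : ∀ t ∈ Icc (0:ℝ) 1, φ t ∈ D := fun t ht => hKD (hφ t ht)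
  have hℓint := h.intervalIntegrable_localAction hD hℓcont hℓnonneg hℓhom hφD ha hc
  obtain ⟨B, -, hB⟩ := exists_localAction_le hℓcont hℓhom
    (isCompact_singleton (x := φ a)) (singleton_subset_iff.2 (hφD a ha))
  have hgc := continuous_localAction hℓcont (hφD a ha)
  have hgint : IntervalIntegrable (fun t => ℓ (φ a) (φ' t)) volume a c := by
    refine (hint.norm.const_mul B).mono_fun'
      (hgc.comp_aestronglyMeasurable hint.def'.aestronglyMeasurable) ?_
    refine Eventually.of_forall fun t => ?_
    simp only
    rw [Real.norm_of_nonneg (hℓnonneg _ (hφD a ha) _)]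
    exact hB _ rfl _
  rw [h.sub_eq ha hc]
  refine ((hℓconv _ (hφD a ha)).map_intervalIntegral_le hgc (hℓhom _ (hφD a ha)) hac hint
    hgint).trans ?_
  rw [← intervalIntegral.integral_const_mul, ← intervalIntegral.integral_add hℓint
    (hint.norm.const_mul ε)]
  refine intervalIntegral.integral_mono_on hac hgint (hℓint.add (hint.norm.const_mul ε)) ?_
  intro t ht
  have ht01 : t ∈ Icc (0:ℝ) 1 := ⟨ha.1.trans ht.1, ht.2.trans hc.2⟩
  refine hmod _ (hφ t ht01) _ (hφ a ha) ?_ _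
  rw [dist_eq_norm]
  refine (h.norm_sub_le ha ht01 ht.1).trans_lt (lt_of_le_of_lt ?_ hδ)
  exact intervalIntegral.integral_mono_interval le_rfl ht.1 ht.2
    (Eventually.of_forall fun _ => norm_nonneg _) hint.norm

end LowerSemicontinuity
section Compactness

variable {n : ℕ} {D : Set (Euc n)} {ℓ : Euc n → Euc n → ℝ}

lemma localAction_le_of_hasDerivAt
    (hℓcont : ContinuousOn (fun p : Euc n × Euc n => ℓ p.1 p.2) (D ×ˢ univ))
    (hℓhom : ∀ x ∈ D, ∀ y : Euc n, ∀ c : ℝ, 0 ≤ c → ℓ x (c • y) = c * ℓ x y)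
    {η : ℝ} (hη : 0 ≤ η) {θ : ℝ → Euc n} {Λ : ℝ → ℝ} {t d : ℝ} {y : Euc n}
    (hθD : θ t ∈ D) (hθ : HasDerivAt θ y t) (hΛ : HasDerivAt Λ d t)
    (hle : ∀ ε > 0, ∃ δ > 0, ∀ v, t ≤ v → v - t < δ →
      ℓ (θ t) (θ v - θ t) ≤ Λ v - Λ t + ε * (η * (v - t))) :
    ℓ (θ t) y ≤ d := by
  refine le_of_forall_pos_le_add fun ε hε => ?_
  obtain ⟨δ, hδ, h⟩ := hle (ε / (η + 1)) (by positivity)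
  have h1 : Tendsto (fun s : ℝ => ℓ (θ t) (s⁻¹ • (θ (t + s) - θ t))) (𝓝[>] 0) (𝓝 (ℓ (θ t) y)) :=
    ((continuous_localAction hℓcont hθD).tendsto y).comp hθ.tendsto_slope_zero_right
  have h2 : Tendsto (fun s : ℝ => s⁻¹ • (Λ (t + s) - Λ t) + ε) (𝓝[>] 0) (𝓝 (d + ε)) :=
    hΛ.tendsto_slope_zero_right.add tendsto_const_nhds
  refine le_of_tendsto_of_tendsto h1 h2 ?_
  filter_upwards [Ioo_mem_nhdsGT hδ] with s hs
  have hs0 : 0 < s := hs.1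
  have h3 := h (t + s) (by linarith) (by simpa using hs.2)
  rw [add_sub_cancel_left] at h3
  rw [hℓhom _ hθD _ _ (inv_nonneg.2 hs0.le), smul_eq_mul]
  have h4 : ε / (η + 1) * (η * s) ≤ ε * s := by
    rw [div_mul_eq_mul_div, div_le_iff₀ (by positivity)]
    nlinarith [mul_pos hε hs0]
  calc s⁻¹ * ℓ (θ t) (θ (t + s) - θ t) ≤ s⁻¹ * (Λ (t + s) - Λ t + ε * s) := by
        gcongr; linarith
    _ = s⁻¹ * (Λ (t + s) - Λ t) + ε := by field_simp

/-- Curves of uniformly bounded length inside a compact set have a limit curve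
along which the action is at most the limit of the actions. -/
theorem exists_limit_curve (hD : IsOpen D)
    (hℓcont : ContinuousOn (fun p : Euc n × Euc n => ℓ p.1 p.2) (D ×ˢ univ))
    (hℓnonneg : ∀ x ∈ D, ∀ y : Euc n, 0 ≤ ℓ x y)
    (hℓhom : ∀ x ∈ D, ∀ y : Euc n, ∀ c : ℝ, 0 ≤ c → ℓ x (c • y) = c * ℓ x y)
    (hℓconv : ∀ x ∈ D, ConvexOn ℝ univ (fun y => ℓ x y))
    {K : Set (Euc n)} (hK : IsCompact K) (hKD : K ⊆ D) {η : ℝ≥0} {m : ℝ} {x₁ x₂ : Euc n}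
    {φ φ' : ℕ → ℝ → Euc n} (hAC : ∀ k, GeoAC (φ k) (φ' k))
    (hφ : ∀ k, ∀ t ∈ Icc (0:ℝ) 1, φ k t ∈ K) (h0 : ∀ k, φ k 0 = x₁) (h1 : ∀ k, φ k 1 = x₂)
    (hlen : ∀ k, geoLen (φ' k) < η)
    (hm : Tendsto (fun k => geoAction ℓ (φ k) (φ' k)) atTop (𝓝 m)) :
    ∃ θ θ' : ℝ → Euc n, GeoAC θ θ' ∧ (∀ t ∈ Icc (0:ℝ) 1, θ t ∈ K) ∧ θ 0 = x₁ ∧ θ 1 = x₂ ∧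
      geoLen θ' ≤ η ∧ geoAction ℓ θ θ' ≤ m := by
  choose β hmono hβ hβ0 hβ1 hlip using fun k => (hAC k).exists_reparametrization (hlen k)
  have hφD : ∀ k, ∀ t ∈ Icc (0:ℝ) 1, φ k t ∈ D := fun k t ht => hKD (hφ k t ht)
  have hI0 : (0:ℝ) ∈ Icc (0:ℝ) 1 := by simp
  have hint : ∀ k, ∀ a ∈ Icc (0:ℝ) 1, ∀ c ∈ Icc (0:ℝ) 1,
      IntervalIntegrable (fun t => ℓ (φ k t) (φ' k t)) volume a c := fun k a ha c hc =>
    (hAC k).intervalIntegrable_localAction hD hℓcont hℓnonneg hℓhom (hφD k) ha hc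
  obtain ⟨B, hB0, hB⟩ := exists_localAction_le hℓcont hℓhom hK hKD
  set A : ℕ → ℝ → ℝ := fun k u => ∫ t in (0:ℝ)..(β k u), ℓ (φ k t) (φ' k t) with hA
  have hAsub : ∀ k u v, A k v - A k u = ∫ t in (β k u)..(β k v), ℓ (φ k t) (φ' k t) :=
    fun k u v => intervalIntegral.integral_interval_sub_left (hint k _ hI0 _ (hβ k v))
      (hint k _ hI0 _ (hβ k u))
  have hA0 : ∀ k, A k 0 = 0 := fun k => by simp [hA, hβ0]
  have hA1 : ∀ k, A k 1 = geoAction ℓ (φ k) (φ' k) := fun k => by simp [hA, hβ1, geoAction]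
  have hmem : ∀ k u v, ∀ t ∈ Icc (β k u) (β k v), t ∈ Icc (0:ℝ) 1 := fun k u v t ht =>
    ⟨(hβ k u).1.trans ht.1, ht.2.trans (hβ k v).2⟩
  have hAlip : ∀ k, LipschitzWith (B.toNNReal * η) (A k) := by
    intro k
    refine LipschitzWith.of_dist_le_mul fun u v => ?_
    wlog huv : u ≤ v generalizing u v
    · rw [dist_comm, dist_comm u v]; exact this v u (le_of_not_ge huv)
    rw [dist_comm, dist_comm u v, Real.dist_eq, Real.dist_eq, hAsub,
      abs_of_nonneg (sub_nonneg.2 huv), abs_of_nonneg (intervalIntegral.integral_nonneg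
        (hmono k huv) fun t ht => hℓnonneg _ (hφD k _ (hmem k u v t ht)) _)]
    have hn := ((hAC k).intervalIntegrable (hβ k u) (hβ k v)).norm.const_mul B
    calc (∫ t in (β k u)..(β k v), ℓ (φ k t) (φ' k t))
        ≤ ∫ t in (β k u)..(β k v), B * ‖φ' k t‖ :=
          intervalIntegral.integral_mono_on (hmono k huv) (hint k _ (hβ k u) _ (hβ k v)) hn
            fun t ht => hB _ (hφ k _ (hmem k u v t ht)) _
      _ ≤ B * (η * (v - u)) := by
          rw [intervalIntegral.integral_const_mul]
          exact mul_le_mul_of_nonneg_left (hlip k u v huv) hB0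
      _ = _ := by push_cast [Real.coe_toNNReal _ hB0]; ring
  have hθlip : ∀ k, LipschitzWith η (fun u => φ k (β k u)) := fun k =>
    (hAC k).lipschitzWith_reparametrization (hmono k) (hβ k) (hlip k)
  let U : Ultrafilter ℕ := Ultrafilter.of atTop
  have hU : (U : Filter ℕ) ≤ atTop := Ultrafilter.of_le _
  have hexθ : ∀ u : ℝ, ∃ z ∈ K, Tendsto (fun k => φ k (β k u)) U (𝓝 z) := fun u =>
    hK.ultrafilter_le_nhds (U.map fun k => φ k (β k u))
      (tendsto_principal.2 (Eventually.of_forall fun k => hφ k _ (hβ k u)))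
  choose θ hθK hθ using hexθ
  have hexΛ : ∀ u : ℝ, ∃ z, Tendsto (fun k => A k u) U (𝓝 z) := by
    intro u
    obtain ⟨z, -, hz⟩ := (isCompact_closedBall (0:ℝ)
      ((B.toNNReal * η : ℝ≥0) * |u|)).ultrafilter_le_nhds (U.map fun k => A k u)
      (tendsto_principal.2 (Eventually.of_forall fun k => by
        have := (hAlip k).dist_le_mul u 0
        rwa [hA0, Real.dist_0_eq_abs u] at this))
    exact ⟨z, hz⟩
  choose Λ hΛ using hexΛ
  have hθL : LipschitzWith η θ := LipschitzWith.of_dist_le_mul fun u v =>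
    le_of_tendsto ((hθ u).dist (hθ v)) (Eventually.of_forall fun k => (hθlip k).dist_le_mul u v)
  have hΛL : LipschitzWith (B.toNNReal * η) Λ := LipschitzWith.of_dist_le_mul fun u v =>
    le_of_tendsto ((hΛ u).dist (hΛ v)) (Eventually.of_forall fun k => (hAlip k).dist_le_mul u v)
  have hΛ0 : Λ 0 = 0 := tendsto_nhds_unique (hΛ 0) (by simp [hA0])
  have hΛ1 : Λ 1 = m := tendsto_nhds_unique (hΛ 1) (by simp only [hA1]; exact hm.mono_left hU)
  have hinc : ∀ ε > 0, ∃ δ > 0, ∀ u v, u ≤ v → v - u < δ →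
      ℓ (θ u) (θ v - θ u) ≤ Λ v - Λ u + ε * (η * (v - u)) := by
    intro ε hε
    obtain ⟨δ, hδ, hmod⟩ := exists_localAction_le_add hℓcont hℓhom hK hKD hε
    refine ⟨δ / (η + 1), by positivity, fun u v huv hlt => ?_⟩
    have hηδ : (η : ℝ) * (v - u) < δ := by
      rw [lt_div_iff₀ (by positivity)] at hlt
      nlinarith [sub_nonneg.2 huv]
    have hc : ContinuousAt (fun p : Euc n × Euc n => ℓ p.1 p.2) (θ u, θ v - θ u) :=
      hℓcont.continuousAt ((hD.prod isOpen_univ).mem_nhds ⟨hKD (hθK u), mem_univ _⟩)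
    have hl : Tendsto (fun k => ℓ (φ k (β k u)) (φ k (β k v) - φ k (β k u))) U
        (𝓝 (ℓ (θ u) (θ v - θ u))) :=
      hc.tendsto.comp ((hθ u).prodMk_nhds ((hθ v).sub (hθ u)))
    refine le_of_tendsto_of_tendsto hl (((hΛ v).sub (hΛ u)).add_const _)
      (Eventually.of_forall fun k => ?_)
    have h2 := hlip k u v huv
    have h3 := (hAC k).localAction_sub_le hD hℓcont hℓnonneg hℓhom hℓconv hKD hmod (hφ k)
      (hβ k u) (hβ k v) (hmono k huv) (h2.trans_lt hηδ)
    simp only [hAsub]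
    refine h3.trans ?_
    gcongr
  have hACθ : GeoAC θ (deriv θ) := GeoAC.of_lipschitzWith hθL
  refine ⟨θ, deriv θ, hACθ, fun t _ => hθK t, ?_, ?_, geoLen_deriv_le_of_lipschitzWith hθL, ?_⟩
  · exact tendsto_nhds_unique (hθ 0) (by simp [hβ0, h0])
  · exact tendsto_nhds_unique (hθ 1) (by simp [hβ1, h1])
  · have hacΛ := (hΛL.lipschitzOnWith (s := uIcc 0 1)).absolutelyContinuousOnInterval
    have hftc := hacΛ.integral_deriv_eq_sub
    rw [hΛ0, hΛ1, sub_zero] at hftc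
    rw [← hftc]
    refine intervalIntegral.integral_mono_ae zero_le_one
      (hACθ.intervalIntegrable_localAction hD hℓcont hℓnonneg hℓhom (fun t _ => hKD (hθK t))
        hI0 (by simp)) hacΛ.intervalIntegrable_deriv ?_
    filter_upwards [hθL.ae_differentiableAt_real, hΛL.ae_differentiableAt_real] with t ht1 ht2
    refine localAction_le_of_hasDerivAt hℓcont hℓhom η.2 (hKD (hθK t)) ht1.hasDerivAt
      ht2.hasDerivAt fun ε hε => ?_
    obtain ⟨δ, hδ, h⟩ := hinc ε hε
    exact ⟨δ, hδ, h t⟩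

end Compactness
section Flow

variable {n : ℕ} {D : Set (Euc n)} {b : Euc n → Euc n} {ψ : Euc n → ℝ → Euc n}

lemma exists_lipschitzOnWith_of_contDiffOn (hD : IsOpen D) (hb : ContDiffOn ℝ 1 b D)
    {K : Set (Euc n)} (hK : IsCompact K) (hKD : K ⊆ D) : ∃ L, LipschitzOnWith L b K := by
  refine LocallyLipschitzOn.exists_lipschitzOnWith_of_compact hK fun z hz => ?_
  obtain ⟨L, V, hV, hL⟩ := (hb.contDiffAt (hD.mem_nhds (hKD hz))).exists_lipschitzOnWith
  exact ⟨L, V, mem_nhdsWithin_of_mem_nhds hV, hL⟩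

lemma dist_le_of_lipschitzOnWith_of_hasDerivAt {L : ℝ≥0} {C : Set (Euc n)}
    (hL : LipschitzOnWith L b C) {γ₁ γ₂ : ℝ → Euc n} {T : ℝ}
    (h₁ : ∀ t, HasDerivAt γ₁ (b (γ₁ t)) t) (h₂ : ∀ t, HasDerivAt γ₂ (b (γ₂ t)) t)
    (hC₁ : ∀ t ∈ Icc 0 T, γ₁ t ∈ C) (hC₂ : ∀ t ∈ Icc 0 T, γ₂ t ∈ C) {t : ℝ} (ht : t ∈ Icc 0 T) :
    dist (γ₁ t) (γ₂ t) ≤ dist (γ₁ 0) (γ₂ 0) * Real.exp (L * t) := by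
  simpa using dist_le_of_trajectories_ODE_of_mem (v := fun _ => b) (s := fun _ => C)
    (fun _ _ => hL) (fun s _ => (h₁ s).continuousAt.continuousWithinAt)
    (fun s _ => (h₁ s).hasDerivWithinAt) (fun s hs => hC₁ s (Ico_subset_Icc_self hs))
    (fun s _ => (h₂ s).continuousAt.continuousWithinAt)
    (fun s _ => (h₂ s).hasDerivWithinAt) (fun s hs => hC₂ s (Ico_subset_Icc_self hs)) le_rfl t ht

lemma integralCurve_eq_of_nonneg (hD : IsOpen D) (hb : ContDiffOn ℝ 1 b D) {γ₁ γ₂ : ℝ → Euc n}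
    (h₁ : ∀ t, HasDerivAt γ₁ (b (γ₁ t)) t) (h₂ : ∀ t, HasDerivAt γ₂ (b (γ₂ t)) t)
    (hD₁ : ∀ t, γ₁ t ∈ D) (hD₂ : ∀ t, γ₂ t ∈ D) (h0 : γ₁ 0 = γ₂ 0) {t : ℝ} (ht : 0 ≤ t) :
    γ₁ t = γ₂ t := by
  have hc₁ : Continuous γ₁ := continuous_iff_continuousAt.2 fun s => (h₁ s).continuousAt
  have hc₂ : Continuous γ₂ := continuous_iff_continuousAt.2 fun s => (h₂ s).continuousAt
  obtain ⟨L, hL⟩ := exists_lipschitzOnWith_of_contDiffOn hD hb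
    (K := γ₁ '' Icc 0 t ∪ γ₂ '' Icc 0 t)
    ((isCompact_Icc.image hc₁).union (isCompact_Icc.image hc₂))
    (union_subset (image_subset_iff.2 fun s _ => hD₁ s) (image_subset_iff.2 fun s _ => hD₂ s))
  have := dist_le_of_lipschitzOnWith_of_hasDerivAt hL h₁ h₂
    (fun s hs => Or.inl (mem_image_of_mem _ hs)) (fun s hs => Or.inr (mem_image_of_mem _ hs))
    (right_mem_Icc.2 ht)
  rw [h0, dist_self, zero_mul] at this
  exact dist_le_zero.1 this

lemma GeoIsFlow.neg (hψ : GeoIsFlow D b ψ) :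
    GeoIsFlow D (fun w => -b w) (fun w t => ψ w (-t)) := by
  refine ⟨fun w hw => by simpa using hψ.1 w hw, fun w hw t => hψ.2.1 w hw _, fun w hw t => ?_⟩
  have := (hψ.2.2 w hw (-t)).scomp t (hasDerivAt_neg t)
  rwa [neg_one_smul] at this

lemma GeoIsFlow.add (hD : IsOpen D) (hb : ContDiffOn ℝ 1 b D) (hψ : GeoIsFlow D b ψ)
    {w : Euc n} (hw : w ∈ D) (s t : ℝ) : ψ (ψ w s) t = ψ w (s + t) := by
  have key : ∀ (b : Euc n → Euc n) (ψ : Euc n → ℝ → Euc n), ContDiffOn ℝ 1 b D →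
      GeoIsFlow D b ψ → ∀ s t, 0 ≤ t → ψ (ψ w s) t = ψ w (s + t) := by
    intro b ψ hb hψ s t ht
    refine integralCurve_eq_of_nonneg hD hb (γ₂ := fun t => ψ w (s + t))
      (hψ.2.2 _ (hψ.2.1 w hw s))
      (fun u => ?_) (hψ.2.1 _ (hψ.2.1 w hw s)) (fun u => hψ.2.1 w hw _) ?_ ht
    · simpa using (hψ.2.2 w hw (s + u)).comp_const_add s u
    · simpa using hψ.1 _ (hψ.2.1 w hw s)
  rcases le_total 0 t with ht | ht
  · exact key b ψ hb hψ s t ht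
  · have := key _ _ hb.neg hψ.neg (-s) (-t) (by linarith)
    simpa [add_comm] using this

lemma GeoIsFlow.locallyLipschitzOn_of_nonneg (hD : IsOpen D) (hb : ContDiffOn ℝ 1 b D)
    (hψ : GeoIsFlow D b ψ) {t : ℝ} (ht : 0 ≤ t) : LocallyLipschitzOn D (fun w => ψ w t) := by
  intro p hp
  have hcont : ∀ w ∈ D, Continuous (ψ w) := fun w hw =>
    continuous_iff_continuousAt.2 fun s => (hψ.2.2 w hw s).continuousAt
  have hcomp : IsCompact (ψ p '' Icc 0 t) := isCompact_Icc.image (hcont p hp)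
  obtain ⟨δ, hδ, hsub⟩ := hcomp.exists_cthickening_subset_open hD
    (image_subset_iff.2 fun s _ => hψ.2.1 p hp s)
  obtain ⟨L, hL⟩ := exists_lipschitzOnWith_of_contDiffOn hD hb hcomp.cthickening hsub
  have hmem : ∀ w s, s ∈ Icc 0 t → dist (ψ w s) (ψ p s) ≤ δ →
      ψ w s ∈ Metric.cthickening δ (ψ p '' Icc 0 t) := fun w s hs h =>
    Metric.mem_cthickening_of_dist_le _ _ _ _ (mem_image_of_mem _ hs) h
  set ε := δ * Real.exp (-(L * t)) with hε
  have hεpos : 0 < ε := by positivity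
  have hstay : ∀ w ∈ D, dist w p < ε → ∀ s ∈ Icc 0 t, dist (ψ w s) (ψ p s) < δ := by
    intro w hw hwp
    by_contra! hcon
    set T := {s ∈ Icc 0 t | δ ≤ dist (ψ w s) (ψ p s)} with hT
    have hTc : IsCompact T := by
      have hcl : IsClosed {s | δ ≤ dist (ψ w s) (ψ p s)} :=
        isClosed_le continuous_const ((hcont w hw).dist (hcont p hp))
      exact isCompact_Icc.inter_right hcl
    obtain ⟨τ, hτ, hmin⟩ := hTc.exists_isLeast hcon
    have hlt : ∀ s ∈ Ico 0 τ, dist (ψ w s) (ψ p s) < δ := by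
      intro s hs
      by_contra! hge
      exact absurd (hmin ⟨⟨hs.1, hs.2.le.trans hτ.1.2⟩, hge⟩) (not_le.2 hs.2)
    have hsmall : dist (ψ w 0) (ψ p 0) < δ := by
      rw [hψ.1 w hw, hψ.1 p hp]
      refine hwp.trans_le (mul_le_of_le_one_right hδ.le (Real.exp_le_one_iff.2 ?_))
      have : 0 ≤ (L : ℝ) * t := by positivity
      linarith
    have hτ0 : 0 < τ := by
      rcases hτ.1.1.eq_or_lt with h | h
      · rw [← h] at hτ; exact absurd hτ.2 (not_le.2 hsmall)
      · exact h
    have hle : ∀ s ∈ Icc 0 τ, dist (ψ w s) (ψ p s) ≤ δ := by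
      have hcl : IsClosed {s | dist (ψ w s) (ψ p s) ≤ δ} :=
        isClosed_le ((hcont w hw).dist (hcont p hp)) continuous_const
      intro s hs
      have := closure_minimal (fun s hs => (hlt s hs).le) hcl
      exact this (by rwa [closure_Ico hτ0.ne])
    have hgr := dist_le_of_lipschitzOnWith_of_hasDerivAt hL (hψ.2.2 w hw) (hψ.2.2 p hp)
      (fun s hs => hmem w s ⟨hs.1, hs.2.trans hτ.1.2⟩ (hle s hs))
      (fun s hs => hmem p s ⟨hs.1, hs.2.trans hτ.1.2⟩ (by simpa using hδ.le))
      (right_mem_Icc.2 hτ0.le)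
    rw [hψ.1 w hw, hψ.1 p hp] at hgr
    refine absurd (hτ.2.trans hgr) (not_le.2 ?_)
    calc dist w p * Real.exp (L * τ) ≤ dist w p * Real.exp (L * t) := by
          gcongr; exact hτ.1.2
      _ < ε * Real.exp (L * t) := by gcongr
      _ = δ := by rw [hε, mul_assoc, ← Real.exp_add]; simp
  refine ⟨(Real.exp (L * t)).toNNReal,
    Metric.ball p ε ∩ D, inter_mem (mem_nhdsWithin_of_mem_nhds (Metric.ball_mem_nhds p hεpos))
      self_mem_nhdsWithin, ?_⟩
  refine LipschitzOnWith.of_dist_le_mul fun w hw z hz => ?_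
  have hgr := dist_le_of_lipschitzOnWith_of_hasDerivAt hL (hψ.2.2 w hw.2) (hψ.2.2 z hz.2)
    (fun s hs => hmem w s hs (hstay w hw.2 hw.1 s hs).le)
    (fun s hs => hmem z s hs (hstay z hz.2 hz.1 s hs).le) (right_mem_Icc.2 ht)
  rwa [hψ.1 w hw.2, hψ.1 z hz.2, mul_comm, ← Real.coe_toNNReal _ (Real.exp_pos _).le] at hgr

lemma GeoIsFlow.locallyLipschitzOn (hD : IsOpen D) (hb : ContDiffOn ℝ 1 b D)
    (hψ : GeoIsFlow D b ψ) (t : ℝ) : LocallyLipschitzOn D (fun w => ψ w t) := by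
  rcases le_total 0 t with ht | ht
  · exact hψ.locallyLipschitzOn_of_nonneg hD hb ht
  · simpa using hψ.neg.locallyLipschitzOn_of_nonneg hD hb.neg (t := -t) (by linarith)

end Flow

section Transversality

variable {n : ℕ} {D : Set (Euc n)} {b : Euc n → Euc n} {ψ : Euc n → ℝ → Euc n}
  {ℓ : Euc n → Euc n → ℝ} {g : Euc n → ℝ}

lemma abs_sub_le_of_lipschitzOnWith_of_hasDerivAt {L : ℝ≥0} {V : Set (Euc n)} {w y₁ y₂ : Euc n}
    (hV : V ∈ 𝓝 w) (hL : LipschitzOnWith L g V) {u₁ u₂ : ℝ → Euc n} {t d₁ d₂ : ℝ}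
    (h₁ : u₁ t = w) (h₂ : u₂ t = w) (hu₁ : HasDerivAt u₁ y₁ t) (hu₂ : HasDerivAt u₂ y₂ t)
    (hd₁ : HasDerivAt (fun τ => g (u₁ τ)) d₁ t) (hd₂ : HasDerivAt (fun τ => g (u₂ τ)) d₂ t) :
    |d₁ - d₂| ≤ L * ‖y₁ - y₂‖ := by
  have ht₁ := (hasDerivAt_iff_tendsto_slope.1 (hd₁.sub hd₂)).norm
  have ht₂ := ((hasDerivAt_iff_tendsto_slope.1 (hu₁.sub hu₂)).norm).const_mul (L : ℝ)
  refine le_of_tendsto_of_tendsto ht₁ ht₂ (Filter.Eventually.filter_mono nhdsWithin_le_nhds ?_)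
  have e₁ : ∀ᶠ τ in 𝓝 t, u₁ τ ∈ V := hu₁.continuousAt.eventually_mem (by rwa [h₁])
  have e₂ : ∀ᶠ τ in 𝓝 t, u₂ τ ∈ V := hu₂.continuousAt.eventually_mem (by rwa [h₂])
  filter_upwards [e₁, e₂] with τ hτ₁ hτ₂
  have := hL.dist_le_mul _ hτ₁ _ hτ₂
  rw [dist_eq_norm, dist_eq_norm] at this
  simp only [slope_def_module, Pi.sub_apply, h₁, h₂, sub_self, sub_zero, norm_smul]
  calc _ ≤ ‖(τ - t)⁻¹‖ * (L * ‖u₁ τ - u₂ τ‖) := by gcongr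
    _ = _ := by ring

lemma le_mul_norm_of_hasDerivAt_flow (hψ : GeoIsFlow D b ψ) {L : ℝ≥0} {V : Set (Euc n)}
    {w : Euc n} (hw : w ∈ D) (hV : V ∈ 𝓝 w) (hL : LipschitzOnWith L g V) {q : ℝ}
    (hq : HasDerivAt (fun τ => g (ψ w τ)) q 0) : q ≤ L * ‖b w‖ := by
  have h0 := hψ.2.2 w hw 0
  rw [hψ.1 w hw] at h0
  have := abs_sub_le_of_lipschitzOnWith_of_hasDerivAt hV hL (hψ.1 w hw) rfl h0
    (hasDerivAt_const (0 : ℝ) w) hq (hasDerivAt_const (0 : ℝ) (g w))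
  simp only [sub_zero] at this
  exact (le_abs_self q).trans this

lemma le_deriv_of_drift (hψ : GeoIsFlow D b ψ) {L : ℝ≥0} {V : Set (Euc n)}
    {w : Euc n} (hw : w ∈ D) (hV : V ∈ 𝓝 w) (hL : LipschitzOnWith L g V) {q c B A : ℝ}
    (hq : HasDerivAt (fun τ => g (ψ w τ)) q 0) (hc : 0 < c) (hcq : c ≤ q) (hB : ‖b w‖ ≤ B)
    (hA : 0 < A) (hdrift : ∀ y, A * (‖b w‖ * ‖y‖ - ⟪b w, y⟫) ≤ ℓ w y)
    {φ : ℝ → Euc n} {t d : ℝ} {y : Euc n} (hφt : φ t = w) (hφ : HasDerivAt φ y t)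
    (hd : HasDerivAt (fun τ => g (φ τ)) d t) :
    c / (2 * B) * ‖y‖ - L ^ 2 / (A * c) * ℓ w y ≤ d := by
  have hbpos : 0 < ‖b w‖ := by
    have := le_mul_norm_of_hasDerivAt_flow hψ hw hV hL hq
    by_contra hcon
    rw [le_antisymm (not_lt.1 hcon) (norm_nonneg _), mul_zero] at this
    linarith
  set r := ‖y‖ / ‖b w‖ with hr
  have hr0 : 0 ≤ r := by positivity
  have hrb : r * ‖b w‖ = ‖y‖ := div_mul_cancel₀ _ hbpos.ne'
  have haff : HasDerivAt (fun τ : ℝ => r * (τ - t)) r t := by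
    simpa using ((hasDerivAt_id t).sub_const t).const_mul r
  have h0 := hψ.2.2 w hw 0
  rw [hψ.1 w hw] at h0
  have hu : HasDerivAt (fun τ => ψ w (r * (τ - t))) (r • b w) t :=
    HasDerivAt.scomp (h := fun τ : ℝ => r * (τ - t)) t (by simpa using h0) haff
  have hgu : HasDerivAt (fun τ => g (ψ w (r * (τ - t)))) (q * r) t :=
    HasDerivAt.comp (h := fun τ : ℝ => r * (τ - t)) (h₂ := fun τ => g (ψ w τ)) t
      (by simpa using hq) haff
  have hcmp := abs_sub_le_of_lipschitzOnWith_of_hasDerivAt hV hL hφt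
    (by simpa using hψ.1 w hw) hφ hu hd hgu
  have hsq : ‖y - r • b w‖ ^ 2 = 2 * r * (‖b w‖ * ‖y‖ - ⟪b w, y⟫) := by
    rw [norm_sub_sq_real, norm_smul, real_inner_smul_right, Real.norm_of_nonneg hr0, hrb,
      real_inner_comm]
    linear_combination (-2 : ℝ) * ‖y‖ * hrb
  set X := L ^ 2 / (A * c) * ℓ w y with hX
  have hℓ : 0 ≤ ℓ w y := le_trans
    (mul_nonneg hA.le (sub_nonneg.2 (real_inner_le_norm _ _))) (hdrift y)
  have hX0 : 0 ≤ X := by positivity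
  have hkey : L * ‖y - r • b w‖ ≤ r * c / 2 + X := by
    refine abs_le_of_sq_le_sq' ?_ (by positivity) |>.2
    have h1 : (L * ‖y - r • b w‖) ^ 2 ≤ 4 * (r * c / 2) * X := by
      calc (L * ‖y - r • b w‖) ^ 2
          = 2 * r * L ^ 2 / A * (A * (‖b w‖ * ‖y‖ - ⟪b w, y⟫)) := by
            rw [mul_pow, hsq]; field_simp
        _ ≤ 2 * r * L ^ 2 / A * ℓ w y := by gcongr; exact hdrift y
        _ = 4 * (r * c / 2) * X := by rw [hX]; field_simp; ring
    nlinarith [sq_nonneg (r * c / 2 - X)]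
  have h2 : c / (2 * B) * ‖y‖ ≤ r * c / 2 := by
    have hBpos : 0 < B := hbpos.trans_le hB
    rw [div_mul_eq_mul_div, div_le_iff₀ (by positivity), ← hrb]
    have : r * c * ‖b w‖ ≤ r * c * B := by gcongr
    linarith
  have h3 : r * c ≤ q * r := by rw [mul_comm]; gcongr
  have := (abs_le.1 hcmp).1
  linarith

end Transversality

/-- Along every curve through a point of `V` at which `g` is differentiable, the derivative of `g`
is bounded below by `κ |φ'| - C ℓ(φ, φ')`. -/
def IsTransversalOn {n : ℕ} (ℓ : Euc n → Euc n → ℝ) (g : Euc n → ℝ) (κ C : ℝ)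
    (V : Set (Euc n)) : Prop :=
  ∀ (φ : ℝ → Euc n) (t : ℝ) (y : Euc n) (d : ℝ), φ t ∈ V → HasDerivAt φ y t →
    HasDerivAt (fun τ => g (φ τ)) d t → κ * ‖y‖ - C * ℓ (φ t) y ≤ d

section LocalizingFunction

variable {n : ℕ} {D : Set (Euc n)} {b : Euc n → Euc n} {ψ : Euc n → ℝ → Euc n}
  {ℓ : Euc n → Euc n → ℝ}

lemma IsTransversalOn.weaken (hℓnonneg : ∀ x ∈ D, ∀ y : Euc n, 0 ≤ ℓ x y) {g : Euc n → ℝ}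
    {κ κ' C C' : ℝ} {V : Set (Euc n)} (hVD : V ⊆ D) (h : IsTransversalOn ℓ g κ C V)
    (hκ : κ' ≤ κ) (hC : C ≤ C') : IsTransversalOn ℓ g κ' C' V := by
  intro φ t y d ht hφ hd
  refine le_trans (sub_le_sub ?_ ?_) (h φ t y d ht hφ hd)
  · gcongr
  · have := hℓnonneg _ (hVD ht) y
    gcongr

lemma exists_isTransversalOn_of_mem (hD : IsOpen D) (hb : ContDiffOn ℝ 1 b D)
    (hdrift : ∀ K ⊆ D, IsCompact K → ∃ A > (0:ℝ), ∀ x ∈ K, ∀ y : Euc n,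
      A * (‖b x‖ * ‖y‖ - ⟪b x, y⟫) ≤ ℓ x y)
    (hψ : GeoIsFlow D b ψ) {f : Euc n → ℝ} {U : Set (Euc n)} (hU : IsOpen U) (hUD : U ⊆ D)
    (hf : ContDiffOn ℝ 1 f U) {z : Euc n} (hz : z ∈ U) (hpos : 0 < fderiv ℝ f z (b z)) (s : ℝ) :
    ∃ V, IsOpen V ∧ ψ z s ∈ V ∧ V ⊆ D ∧ LocallyLipschitzOn V (fun w => f (ψ w (-s))) ∧
      ∃ κ > 0, ∃ C ≥ 0, IsTransversalOn ℓ (fun w => f (ψ w (-s))) κ C V := by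
  set p := ψ z s with hp
  have hzD := hUD hz
  have hpD : p ∈ D := hψ.2.1 z hzD s
  have hDp : D ∈ 𝓝 p := hD.mem_nhds hpD
  have hpz : ψ p (-s) = z := by rw [hp, hψ.add hD hb hzD, add_neg_cancel, hψ.1 z hzD]
  obtain ⟨L₁, T₁, hT₁, hL₁⟩ := (hf.contDiffAt (hU.mem_nhds hz)).exists_lipschitzOnWith
  have hlip := hψ.locallyLipschitzOn hD hb (-s)
  obtain ⟨L₂, T₂, hT₂, hL₂⟩ := hlip hpD
  rw [nhdsWithin_eq_nhds.2 hDp] at hT₂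
  have hcont : ContinuousAt (fun w => ψ w (-s)) p := hlip.continuousOn.continuousAt hDp
  have hcontz : Tendsto (fun w => ψ w (-s)) (𝓝 p) (𝓝 z) := by
    have := hcont.tendsto
    rwa [hpz] at this
  set q : Euc n → ℝ := fun w => fderiv ℝ f (ψ w (-s)) (b (ψ w (-s))) with hq
  have hqc : Tendsto q (𝓝 p) (𝓝 (fderiv ℝ f z (b z))) := by
    have h1 : ContinuousAt (fderiv ℝ f) z :=
      (hf.continuousOn_fderiv_of_isOpen hU le_rfl).continuousAt (hU.mem_nhds hz)
    have h2 : ContinuousAt b z := hb.continuousOn.continuousAt (hD.mem_nhds hzD)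
    exact (h1.clm_apply h2).tendsto.comp hcontz
  set c := fderiv ℝ f z (b z) / 2 with hc
  have hcpos : 0 < c := by positivity
  obtain ⟨K, hK, hpK, hKD⟩ := exists_compact_subset hD hpD
  obtain ⟨A, hA, hAK⟩ := hdrift K hKD hK
  set B := ‖b p‖ + 1 with hB
  have hbc : ∀ᶠ w in 𝓝 p, ‖b w‖ < B :=
    (hb.continuousOn.continuousAt hDp).norm.eventually_lt continuousAt_const (by simp [hB])
  set W := {w | w ∈ T₂ ∧ ψ w (-s) ∈ T₁ ∧ ψ w (-s) ∈ U ∧ w ∈ K ∧ c < q w ∧ ‖b w‖ < B} with hW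
  have hWp : W ∈ 𝓝 p := by
    filter_upwards [hT₂, hcontz hT₁, hcontz (hU.mem_nhds hz), mem_interior_iff_mem_nhds.1 hpK,
      hqc.eventually_const_lt (half_lt_self hpos), hbc] with w h1 h2 h3 h4 h5 h6
    exact ⟨h1, h2, h3, h4, h5, h6⟩
  have hLip : LipschitzOnWith (L₁ * L₂) (fun w => f (ψ w (-s))) (interior W) :=
    hL₁.comp (hL₂.mono fun w hw => (interior_subset hw).1) fun w hw => (interior_subset hw).2.1
  have hWD : interior W ⊆ D := fun w hw => hKD (interior_subset hw).2.2.2.1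
  refine ⟨interior W, isOpen_interior, mem_interior_iff_mem_nhds.2 hWp, hWD,
    fun w _ => ⟨_, _, self_mem_nhdsWithin, hLip⟩, c / (2 * B), by positivity,
    (L₁ * L₂ : ℝ≥0) ^ 2 / (A * c), by positivity, ?_⟩
  intro φ t y d ht hφ hd
  have hwD := hWD ht
  obtain ⟨-, -, hwU, hwK, hwq, hwB⟩ := interior_subset ht
  refine le_deriv_of_drift hψ hwD (isOpen_interior.mem_nhds ht) hLip (q := q (φ t)) ?_ hcpos
    hwq.le hwB.le hA (hAK _ hwK) rfl hφ hd
  have heq : (fun τ => f (ψ (ψ (φ t) τ) (-s))) = fun τ => f (ψ (ψ (φ t) (-s)) τ) := by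
    funext τ
    rw [hψ.add hD hb hwD, hψ.add hD hb hwD, add_comm]
  rw [heq]
  have hD' := hψ.2.1 _ hwD (-s)
  have h1 := hψ.2.2 _ hD' 0
  have h2 : HasFDerivAt f (fderiv ℝ f (ψ (φ t) (-s))) (ψ (ψ (φ t) (-s)) 0) := by
    rw [hψ.1 _ hD']
    exact ((hf.contDiffAt (hU.mem_nhds hwU)).differentiableAt one_ne_zero).hasFDerivAt
  have h3 := h2.comp_hasDerivAt (0 : ℝ) h1
  rwa [hψ.1 _ hD'] at h3

lemma exists_isTransversalOn_of_isCompact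
    (hℓnonneg : ∀ x ∈ D, ∀ y : Euc n, 0 ≤ ℓ x y) {g : Euc n → ℝ} {N : Set (Euc n)}
    (hN : IsCompact N)
    (hloc : ∀ p ∈ N, ∃ V, IsOpen V ∧ p ∈ V ∧ V ⊆ D ∧ LocallyLipschitzOn V g ∧
      ∃ κ > 0, ∃ C ≥ 0, IsTransversalOn ℓ g κ C V) :
    ∃ V, IsOpen V ∧ N ⊆ V ∧ V ⊆ D ∧ LocallyLipschitzOn V g ∧
      ∃ κ > 0, ∃ C ≥ 0, IsTransversalOn ℓ g κ C V := by
  refine hN.induction_on ?_ ?_ ?_ ?_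
  · exact ⟨∅, isOpen_empty, subset_rfl, empty_subset _, by simp [LocallyLipschitzOn], 1, one_pos,
      0, le_rfl, fun φ t y d ht => absurd ht (notMem_empty _)⟩
  · rintro s t hst ⟨V, hV, htV, h⟩
    exact ⟨V, hV, hst.trans htV, h⟩
  · rintro s t ⟨V, hV, hsV, hVD, hVl, κ, hκ, C, hC, h⟩
      ⟨V', hV', htV', hVD', hVl', κ', hκ', C', hC', h'⟩
    refine ⟨V ∪ V', hV.union hV', union_subset_union hsV htV', union_subset hVD hVD', ?_,
      min κ κ', lt_min hκ hκ', max C C', hC.trans (le_max_left _ _), ?_⟩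
    · rintro w (hw | hw)
      · obtain ⟨L, T, hT, hL⟩ := hVl hw
        rw [hV.nhdsWithin_eq hw] at hT
        exact ⟨L, T, mem_nhdsWithin_of_mem_nhds hT, hL⟩
      · obtain ⟨L, T, hT, hL⟩ := hVl' hw
        rw [hV'.nhdsWithin_eq hw] at hT
        exact ⟨L, T, mem_nhdsWithin_of_mem_nhds hT, hL⟩
    · intro φ t y d ht
      rcases ht with ht | ht
      · exact h.weaken hℓnonneg hVD (min_le_left _ _) (le_max_left _ _) φ t y d ht
      · exact h'.weaken hℓnonneg hVD' (min_le_right _ _) (le_max_right _ _) φ t y d ht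
  · intro p hp
    obtain ⟨V, hV, hpV, hVD, h⟩ := hloc p hp
    exact ⟨V, mem_nhdsWithin_of_mem_nhds (hV.mem_nhds hpV), V, hV, subset_rfl, hVD, h⟩

lemma exists_truncation (hD : IsOpen D) {g : Euc n → ℝ} (hg : ContinuousOn g D)
    {V : Set (Euc n)} (hV : IsOpen V) (hVD : V ⊆ D) (hN : IsCompact {w ∈ D | g w = 0})
    (hNV : {w ∈ D | g w = 0} ⊆ V) (hVl : LocallyLipschitzOn V g) :
    ∃ (h : Euc n → ℝ) (a : ℝ) (R : Set (Euc n)), 0 < a ∧ IsCompact R ∧ R ⊆ V ∧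
      LocallyLipschitzOn D h ∧ (∀ w, |h w| ≤ a) ∧
      ∀ w ∈ D, (g w = 0 → h w = 0) ∧ (|h w| < a → w ∈ R ∧ h =ᶠ[𝓝 w] g) := by
  classical
  obtain ⟨W, hW, hNW, hWV⟩ := exists_compact_between hN hV hNV
  have hWD := hWV.trans hVD
  have hgap : ∃ a > 0, ∀ w ∈ W \ interior W, a < |g w| := by
    rcases (W \ interior W).eq_empty_or_nonempty with he | hne
    · exact ⟨1, one_pos, by simp [he]⟩
    · obtain ⟨w, hw, hmin⟩ := (hW.diff isOpen_interior).exists_isMinOn hne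
        ((hg.mono (sdiff_subset.trans hWD)).abs)
      have hpos : 0 < |g w| := abs_pos.2 fun h0 => hw.2 (hNW ⟨hWD hw.1, h0⟩)
      exact ⟨|g w| / 2, by positivity, fun z hz => (half_lt_self hpos).trans_le (hmin hz)⟩
  obtain ⟨a, ha, hgap⟩ := hgap
  set R := {w ∈ W | |g w| ≤ a} with hR
  have hRW : R ⊆ interior W := fun w hw => by
    by_contra hcon
    exact absurd hw.2 (not_le.2 (hgap w ⟨hw.1, hcon⟩))
  have hRc : IsCompact R := by
    have := (hg.mono hWD).abs.preimage_isClosed_of_isClosed hW.isClosed (isClosed_Iic (a := a))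
    exact hW.of_isClosed_subset this inter_subset_left
  set h : Euc n → ℝ := fun w => if w ∈ R then g w else if 0 < g w then a else -a with hh
  have hclamp : ∀ w ∈ interior W, h w = max (-a) (min a (g w)) := by
    intro w hw
    simp only [hh]
    split_ifs with h1 h2
    · rw [min_eq_right (abs_le.1 h1.2).2, max_eq_right (abs_le.1 h1.2).1]
    · have : a < |g w| := by
        by_contra! hcon; exact h1 ⟨interior_subset hw, hcon⟩
      rw [abs_of_pos h2] at this
      rw [min_eq_left this.le, max_eq_right (by linarith)]
    · have : a < |g w| := by
        by_contra! hcon; exact h1 ⟨interior_subset hw, hcon⟩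
      rw [abs_of_nonpos (not_lt.1 h2)] at this
      rw [min_eq_right (by linarith), max_eq_left (by linarith)]
  have hbound : ∀ w, |h w| ≤ a := by
    intro w
    simp only [hh]
    split_ifs with h1 h2
    · exact h1.2
    · exact (abs_of_pos ha).le
    · rw [abs_neg]; exact (abs_of_pos ha).le
  have hmemR : ∀ w, |h w| < a → w ∈ R := by
    intro w hw
    by_contra hcon
    simp only [hh, if_neg hcon] at hw
    split_ifs at hw
    · exact hw.ne (abs_of_pos ha)
    · rw [abs_neg] at hw; exact hw.ne (abs_of_pos ha)
  refine ⟨h, a, R, ha, hRc, fun w hw => hWV hw.1, ?_, hbound, fun w hw => ⟨fun h0 => ?_,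
    fun hlt => ⟨hmemR w hlt, ?_⟩⟩⟩
  · intro w hw
    by_cases hwR : w ∈ R
    · have hwi := hRW hwR
      obtain ⟨L, T, hT, hL⟩ := hVl (hWV hwR.1)
      rw [hV.nhdsWithin_eq (hWV hwR.1)] at hT
      refine ⟨L, T ∩ interior W, mem_nhdsWithin_of_mem_nhds
        (inter_mem hT (isOpen_interior.mem_nhds hwi)), ?_⟩
      refine LipschitzOnWith.of_dist_le_mul fun u hu v hv => ?_
      rw [hclamp u hu.2, hclamp v hv.2, Real.dist_eq]
      refine (abs_max_sub_max_le_max _ _ _ _).trans ?_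
      rw [sub_self, abs_zero, max_eq_right (abs_nonneg _)]
      refine (abs_min_sub_min_le_max _ _ _ _).trans ?_
      rw [sub_self, abs_zero, max_eq_right (abs_nonneg _)]
      exact hL.dist_le_mul u hu.1 v hv.1
    · have hDR : D \ R ∈ 𝓝 w := (hD.sdiff hRc.isClosed).mem_nhds ⟨hw, hwR⟩
      have hne : g w ≠ 0 := fun h0 =>
        hwR ⟨interior_subset (hNW ⟨hw, h0⟩), by simpa [h0] using ha.le⟩
      have hgc : ContinuousAt g w := hg.continuousAt (hD.mem_nhds hw)
      rcases hne.lt_or_gt with hlt | hgt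
      · refine ⟨0, _, mem_nhdsWithin_of_mem_nhds
          (inter_mem hDR (hgc.eventually_lt continuousAt_const hlt)),
          LipschitzOnWith.of_dist_le_mul fun u hu v hv => ?_⟩
        have hu2 : g u < 0 := hu.2
        have hv2 : g v < 0 := hv.2
        simp only [hh, if_neg hu.1.2, if_neg hv.1.2, if_neg hu2.not_gt, if_neg hv2.not_gt]
        simp
      · refine ⟨0, _, mem_nhdsWithin_of_mem_nhds
          (inter_mem hDR (continuousAt_const.eventually_lt hgc hgt)),
          LipschitzOnWith.of_dist_le_mul fun u hu v hv => ?_⟩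
        have hu2 : 0 < g u := hu.2
        have hv2 : 0 < g v := hv.2
        simp only [hh, if_neg hu.1.2, if_neg hv.1.2, if_pos hu2, if_pos hv2]
        simp
  · have hwR : w ∈ R := ⟨interior_subset (hNW ⟨hw, h0⟩), by simpa [h0] using ha.le⟩
    simp [hh, if_pos hwR, h0]
  · have hwR := hmemR w hlt
    have hlt' : |g w| < a := by simpa [hh, if_pos hwR] using hlt
    have hgc : ContinuousAt g w := hg.continuousAt (hD.mem_nhds hw)
    filter_upwards [hgc.abs.eventually_lt continuousAt_const hlt',
      isOpen_interior.mem_nhds (hRW hwR)] with v hv hvW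
    have : v ∈ R := ⟨interior_subset hvW, hv.le⟩
    simp only [hh, if_pos this]

/-- A bounded, locally Lipschitz function vanishing at a given point of a flowline through an
admissible manifold, such that the local action controls both its decrease and the length of
curves in the region where it is not extremal. -/
theorem exists_localizing_function (hD : IsOpen D)
    (hℓnonneg : ∀ x ∈ D, ∀ y : Euc n, 0 ≤ ℓ x y) (hb : ContDiffOn ℝ 1 b D)
    (hdrift : ∀ K ⊆ D, IsCompact K → ∃ A > (0:ℝ), ∀ x ∈ K, ∀ y : Euc n,
      A * (‖b x‖ * ‖y‖ - ⟪b x, y⟫) ≤ ℓ x y)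
    (hψ : GeoIsFlow D b ψ) {M : Set (Euc n)} (hM : GeoIsAdmissible D b M) {m : Euc n}
    (hm : m ∈ M) (s : ℝ) :
    ∃ (h : Euc n → ℝ) (a : ℝ) (R : Set (Euc n)), 0 < a ∧ IsCompact R ∧ R ⊆ D ∧
      LocallyLipschitzOn D h ∧ (∀ w, |h w| ≤ a) ∧ h (ψ m s) = 0 ∧
      (∀ w ∈ D, |h w| < a → w ∈ R) ∧
      ∃ κ > 0, ∃ C ≥ 0, IsTransversalOn ℓ h κ C {w ∈ D | |h w| < a} := by
  obtain ⟨f, hf, hMf, hMc, ⟨U, hU, hMU, hUD, hfU⟩, hpos⟩ := hM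
  have hlip := hψ.locallyLipschitzOn hD hb
  set g : Euc n → ℝ := fun w => f (ψ w (-s)) with hg
  have hgc : ContinuousOn g D :=
    hf.comp (hlip (-s)).continuousOn fun w hw => hψ.2.1 w hw _
  have hback : ∀ w ∈ D, ψ (ψ w (-s)) s = w := fun w hw => by
    rw [hψ.add hD hb hw, neg_add_cancel, hψ.1 w hw]
  have hNimage : {w ∈ D | g w = 0} = (fun w => ψ w s) '' M := by
    ext w
    rw [hMf]
    constructor
    · rintro ⟨hw, h0⟩
      exact ⟨ψ w (-s), ⟨hψ.2.1 w hw _, h0⟩, hback w hw⟩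
    · rintro ⟨z, ⟨hz, h0⟩, rfl⟩
      refine ⟨hψ.2.1 z hz s, ?_⟩
      simp only [hg]
      rw [hψ.add hD hb hz, add_neg_cancel, hψ.1 z hz, h0]
  have hN : IsCompact {w ∈ D | g w = 0} := by
    rw [hNimage]
    exact hMc.image_of_continuousOn ((hlip s).continuousOn.mono (hMU.trans hUD))
  obtain ⟨V, hV, hNV, hVD, hVl, κ, hκ, C, hC, htr⟩ :=
    exists_isTransversalOn_of_isCompact (D := D) (g := g) hℓnonneg hN (by
      rw [hNimage]
      rintro _ ⟨z, hz, rfl⟩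
      exact exists_isTransversalOn_of_mem hD hb hdrift hψ hU hUD hfU (hMU hz)
        (by simpa only [inner_gradient_left] using hpos z hz) s)
  obtain ⟨h, a, R, ha, hR, hRV, hhl, hbound, hh⟩ := exists_truncation hD hgc hV hVD hN hNV hVl
  have hx : ψ m s ∈ {w ∈ D | g w = 0} := by rw [hNimage]; exact mem_image_of_mem _ hm
  refine ⟨h, a, R, ha, hR, hRV.trans hVD, hhl, hbound, (hh _ hx.1).1 hx.2,
    fun w hw hlt => ((hh w hw).2 hlt).1, κ, hκ, C, hC, ?_⟩
  intro φ t y d ht hφ hd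
  obtain ⟨hmem, heq⟩ := (hh _ ht.1).2 ht.2
  exact htr φ t y d (hRV hmem) hφ
    (hd.congr_of_eventuallyEq ((hφ.continuousAt.eventually heq).mono fun τ hτ => hτ.symm))

end LocalizingFunction

section ConfinedCurves

variable {n : ℕ} {D : Set (Euc n)} {ℓ : Euc n → Euc n → ℝ} {h : Euc n → ℝ}

lemma GeoAC.absolutelyContinuousOnInterval_comp (hh : LocallyLipschitzOn D h)
    {φ φ' : ℝ → Euc n} (hφ : GeoAC φ φ') (hφD : ∀ t ∈ Icc (0:ℝ) 1, φ t ∈ D) :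
    AbsolutelyContinuousOnInterval (fun t => h (φ t)) 0 1 := by
  obtain ⟨L, hL⟩ := LocallyLipschitzOn.exists_lipschitzOnWith_of_compact
    (isCompact_Icc.image_of_continuousOn hφ.continuousOn)
    (hh.mono (image_subset_iff.2 fun t ht => hφD t ht))
  have h0 : (0:ℝ) ∈ Icc (0:ℝ) 1 := by simp
  have h1 : (1:ℝ) ∈ Icc (0:ℝ) 1 := by simp
  have hint : ∀ {u v : ℝ}, u ∈ Icc (0:ℝ) 1 → v ∈ Icc (0:ℝ) 1 →
      IntervalIntegrable (fun t => ‖φ' t‖) volume u v := fun hu hv =>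
    (hφ.intervalIntegrable hu hv).norm
  have hdist : ∀ u ∈ Icc (0:ℝ) 1, ∀ v ∈ Icc (0:ℝ) 1,
      dist (h (φ u)) (h (φ v)) ≤
        L * dist (∫ t in (0:ℝ)..u, ‖φ' t‖) (∫ t in (0:ℝ)..v, ‖φ' t‖) := by
    intro u hu v hv
    wlog huv : u ≤ v generalizing u v
    · rw [dist_comm, dist_comm (∫ t in (0:ℝ)..u, _)]
      exact this v hv u hu (le_of_not_ge huv)
    refine (hL.dist_le_mul _ (mem_image_of_mem _ hu) _ (mem_image_of_mem _ hv)).trans ?_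
    rw [dist_comm, dist_comm (∫ t in (0:ℝ)..u, _), dist_eq_norm, Real.dist_eq,
      intervalIntegral.integral_interval_sub_left (hint h0 hv) (hint h0 hu)]
    gcongr
    exact (hφ.norm_sub_le hu hv huv).trans (le_abs_self _)
  have hAC := (hint h0 h1).absolutelyContinuousOnInterval_intervalIntegral
    (c := 0) left_mem_uIcc
  rw [absolutelyContinuousOnInterval_iff] at hAC ⊢
  intro ε hε
  obtain ⟨δ, hδ, hE⟩ := hAC (ε / (L + 1)) (by positivity)
  refine ⟨δ, hδ, fun E hEd hEδ => ?_⟩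
  have hmem : ∀ i ∈ Finset.range E.1, (E.2 i).1 ∈ Icc (0:ℝ) 1 ∧ (E.2 i).2 ∈ Icc (0:ℝ) 1 := by
    intro i hi
    have := hEd.1 i hi
    rwa [uIcc_of_le zero_le_one] at this
  calc _ ≤ ∑ i ∈ Finset.range E.1, L * dist (∫ t in (0:ℝ)..(E.2 i).1, ‖φ' t‖)
        (∫ t in (0:ℝ)..(E.2 i).2, ‖φ' t‖) :=
        Finset.sum_le_sum fun i hi => hdist _ (hmem i hi).1 _ (hmem i hi).2
    _ = L * ∑ i ∈ Finset.range E.1, dist (∫ t in (0:ℝ)..(E.2 i).1, ‖φ' t‖)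
        (∫ t in (0:ℝ)..(E.2 i).2, ‖φ' t‖) := by rw [Finset.mul_sum]
    _ ≤ L * (ε / (L + 1)) := by gcongr; exact (hE E hEd hEδ).le
    _ < ε := by
        rw [mul_div_assoc', div_lt_iff₀ (by positivity)]
        nlinarith

/-- Curves of small action whose endpoints are far from the extremal region of `h` avoid that
region, and their length is controlled. -/
theorem GeoAC.confined (hD : IsOpen D)
    (hℓcont : ContinuousOn (fun p : Euc n × Euc n => ℓ p.1 p.2) (D ×ˢ univ))
    (hℓnonneg : ∀ x ∈ D, ∀ y : Euc n, 0 ≤ ℓ x y)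
    (hℓhom : ∀ x ∈ D, ∀ y : Euc n, ∀ c : ℝ, 0 ≤ c → ℓ x (c • y) = c * ℓ x y)
    (hh : LocallyLipschitzOn D h) {a κ C : ℝ} (hha : ∀ w, |h w| ≤ a) (hκ : 0 ≤ κ)
    (hC : 0 ≤ C) (htr : IsTransversalOn ℓ h κ C {w ∈ D | |h w| < a})
    {φ φ' : ℝ → Euc n} (hφ : GeoAC φ φ') (hφD : ∀ t ∈ Icc (0:ℝ) 1, φ t ∈ D)
    (h₀ : |h (φ 0)| + C * geoAction ℓ φ φ' < a) (h₁ : |h (φ 1)| + C * geoAction ℓ φ φ' < a) :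
    (∀ t ∈ Icc (0:ℝ) 1, |h (φ t)| < a) ∧ κ * geoLen φ' ≤ 2 * a := by
  have m0 : (0:ℝ) ∈ Icc (0:ℝ) 1 := by simp
  have m1 : (1:ℝ) ∈ Icc (0:ℝ) 1 := by simp
  have hAC := hφ.absolutelyContinuousOnInterval_comp hh hφD
  have hℓint := fun {u v : ℝ} (hu : u ∈ Icc (0:ℝ) 1) (hv : v ∈ Icc (0:ℝ) 1) =>
    hφ.intervalIntegrable_localAction hD hℓcont hℓnonneg hℓhom hφD hu hv
  set k : ℝ → ℝ := fun t => h (φ t) with hk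
  have hderiv : ∀ᵐ t, t ∈ Ioo (0:ℝ) 1 → HasDerivAt φ (φ' t) t ∧ HasDerivAt k (deriv k t) t := by
    filter_upwards [hφ.ae_hasDerivAt, hAC.ae_differentiableAt] with t ht₁ ht₂ ht
    exact ⟨ht₁ ht, (ht₂ (by rw [uIcc_of_le zero_le_one]; exact Ioo_subset_Icc_self ht)).hasDerivAt⟩
  have hk' : IntervalIntegrable (deriv k) volume 0 1 := hAC.intervalIntegrable_deriv
  have hmono : ∀ (F : ℝ → ℝ) (u v : ℝ), 0 ≤ u → u ≤ v → v ≤ 1 → IntervalIntegrable F volume u v →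
      (∀ᵐ t, t ∈ Ioo (0:ℝ) 1 → F t ≤ deriv k t) → ∫ t in u..v, F t ≤ k v - k u := by
    intro F u v hu huv hv hF hle
    have hsub : uIcc u v ⊆ uIcc 0 1 := by
      rw [uIcc_of_le huv, uIcc_of_le zero_le_one]; exact Icc_subset_Icc hu hv
    rw [← (hAC.mono hsub).integral_deriv_eq_sub]
    refine intervalIntegral.integral_mono_ae_restrict huv hF (hk'.mono_set hsub) ?_
    rw [← restrict_Ioo_eq_restrict_Icc]
    refine (ae_restrict_iff' measurableSet_Ioo).2 ?_
    filter_upwards [hle] with t ht htuv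
    exact ht ⟨hu.trans_lt htuv.1, htuv.2.trans_le hv⟩
  have hlow : ∀ᵐ t, t ∈ Ioo (0:ℝ) 1 → -(C * ℓ (φ t) (φ' t)) ≤ deriv k t := by
    filter_upwards [hderiv] with t ht hmem
    have hφt := hφD t (Ioo_subset_Icc_self hmem)
    have hℓt := mul_nonneg hC (hℓnonneg _ hφt (φ' t))
    rcases (hha (φ t)).lt_or_eq with hlt | heq
    · have := htr φ t _ _ ⟨hφt, hlt⟩ (ht hmem).1 (ht hmem).2
      have := mul_nonneg hκ (norm_nonneg (φ' t))
      linarith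
    · have hzero : deriv k t = 0 := by
        rcases abs_choice (h (φ t)) with hs | hs
        · exact IsLocalMax.deriv_eq_zero (Eventually.of_forall fun τ =>
            (le_abs_self _).trans ((hha (φ τ)).trans_eq (heq.symm.trans hs)))
        · refine IsLocalMin.deriv_eq_zero (Eventually.of_forall fun τ => ?_)
          have := neg_le_of_abs_le (hha (φ τ))
          have e : h (φ t) = -a := by linarith
          exact e.trans_le this
      rw [hzero]
      linarith
  have hS : 0 ≤ geoAction ℓ φ φ' := intervalIntegral.integral_nonneg zero_le_one fun t ht =>
    hℓnonneg _ (hφD t ht) _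
  have hdrop : ∀ u v, 0 ≤ u → u ≤ v → v ≤ 1 → -(C * geoAction ℓ φ φ') ≤ k v - k u := by
    intro u v hu huv hv
    have hmu : u ∈ Icc (0:ℝ) 1 := ⟨hu, huv.trans hv⟩
    have hmv : v ∈ Icc (0:ℝ) 1 := ⟨hu.trans huv, hv⟩
    refine le_trans ?_ (hmono _ u v hu huv hv ((hℓint hmu hmv).const_mul C).neg hlow)
    rw [Pi.neg_def, intervalIntegral.integral_neg, intervalIntegral.integral_const_mul]
    gcongr
    refine intervalIntegral.integral_mono_interval hu huv hv ?_ (hℓint m0 m1)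
    refine (ae_restrict_iff' measurableSet_Ioc).2 (Eventually.of_forall fun t ht => ?_)
    exact hℓnonneg _ (hφD t (Ioc_subset_Icc_self ht)) _
  have hconf : ∀ t ∈ Icc (0:ℝ) 1, |h (φ t)| < a := by
    intro t ht
    have e₁ := hdrop 0 t le_rfl ht.1 ht.2
    have e₂ := hdrop t 1 ht.1 ht.2 le_rfl
    have := neg_abs_le (h (φ 0))
    have := le_abs_self (h (φ 1))
    simp only [hk] at e₁ e₂
    exact abs_lt.2 ⟨by linarith, by linarith⟩
  refine ⟨hconf, ?_⟩
  have hκint := ((hφ.intervalIntegrable m0 m1).norm.const_mul κ).sub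
    ((hℓint m0 m1).const_mul C)
  have := hmono _ 0 1 le_rfl zero_le_one le_rfl hκint (by
    filter_upwards [hderiv] with t ht hmem
    have hmem' := Ioo_subset_Icc_self hmem
    exact htr φ t _ _ ⟨hφD t hmem', hconf t hmem'⟩ (ht hmem).1 (ht hmem).2)
  rw [intervalIntegral.integral_sub ((hφ.intervalIntegrable m0 m1).norm.const_mul κ)
    ((hℓint m0 m1).const_mul C), intervalIntegral.integral_const_mul,
    intervalIntegral.integral_const_mul] at this
  have e₁ := neg_abs_le (h (φ 0))
  have e₂ := le_abs_self (h (φ 1))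
  simp only [hk] at this
  have hCS := mul_nonneg hC hS
  rw [geoLen]
  rw [geoAction] at *
  linarith

end ConfinedCurves

section Competitors

variable {n : ℕ} {D Eset : Set (Euc n)} {ℓ : Euc n → Euc n → ℝ}

lemma GeoAssumpE.exists_lipschitzWith (hE : GeoAssumpE Eset) {x : Euc n} (hx : x ∈ Eset)
    {ν : ℝ≥0} (hν : 0 < ν) :
    ∃ r > 0, ∀ w ∈ Metric.closedBall x r ∩ Eset, ∃ γ : ℝ → Euc n, LipschitzWith ν γ ∧
      (∀ t, γ t ∈ Eset) ∧ γ 0 = x ∧ γ 1 = w := by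
  have hν' : (0 : ℝ) < ν := hν
  obtain ⟨r, hr, h⟩ := hE x hx (ν / 2) (half_pos hν')
  refine ⟨r, hr, fun w hw => ?_⟩
  obtain ⟨φ, φ', hAC, hφE, h0, h1, hlen⟩ := h w hw
  obtain ⟨β, hmono, hβ, hβ0, hβ1, hlip⟩ :=
    hAC.exists_reparametrization (hlen.trans_lt (half_lt_self hν'))
  exact ⟨fun u => φ (β u), hAC.lipschitzWith_reparametrization hmono hβ hlip,
    fun t => hφE _ (hβ t), by simp [hβ0, h0], by simp [hβ1, h1]⟩

lemma GeoAssumpE.exists_lipschitzWith_joining (hE : GeoAssumpE Eset) {x : Euc n} (hx : x ∈ Eset)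
    {ν : ℝ≥0} (hν : 0 < ν) :
    ∃ r > 0, ∀ x₁ ∈ Metric.closedBall x r ∩ Eset, ∀ x₂ ∈ Metric.closedBall x r ∩ Eset,
      ∃ θ : ℝ → Euc n, LipschitzWith ν θ ∧ (∀ t, θ t ∈ Eset) ∧ θ 0 = x₁ ∧ θ 1 = x₂ ∧
        ∀ t ∈ Icc (0:ℝ) 1, dist (θ t) x ≤ ν := by
  obtain ⟨r, hr, h⟩ := hE.exists_lipschitzWith hx (ν := ν / 4) (by positivity)
  refine ⟨r, hr, fun x₁ hx₁ x₂ hx₂ => ?_⟩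
  obtain ⟨γ₁, hl₁, hm₁, h₁0, h₁1⟩ := h x₁ hx₁
  obtain ⟨γ₂, hl₂, hm₂, h₂0, h₂1⟩ := h x₂ hx₂
  have hp₁ : LipschitzWith 2 (fun t : ℝ => max 0 (1 - 2 * t)) := by
    refine LipschitzWith.of_dist_le_mul fun u v => ?_
    rw [Real.dist_eq, Real.dist_eq]
    refine (abs_max_sub_max_le_max _ _ _ _).trans ?_
    rw [sub_self, abs_zero, max_eq_right (abs_nonneg _),
      show 1 - 2 * u - (1 - 2 * v) = -(2 * (u - v)) by ring, abs_neg, abs_mul]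
    simp
  have hp₂ : LipschitzWith 2 (fun t : ℝ => max 0 (2 * t - 1)) := by
    refine LipschitzWith.of_dist_le_mul fun u v => ?_
    rw [Real.dist_eq, Real.dist_eq]
    refine (abs_max_sub_max_le_max _ _ _ _).trans ?_
    rw [sub_self, abs_zero, max_eq_right (abs_nonneg _),
      show 2 * u - 1 - (2 * v - 1) = 2 * (u - v) by ring, abs_mul]
    simp
  set θ : ℝ → Euc n := fun t => γ₁ (max 0 (1 - 2 * t)) + γ₂ (max 0 (2 * t - 1)) - x with hθ
  have hleft : ∀ t ≤ 1 / 2, θ t = γ₁ (max 0 (1 - 2 * t)) := fun t ht => by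
    simp only [hθ]
    rw [max_eq_left (by linarith : 2 * t - 1 ≤ 0), h₂0, add_sub_cancel_right]
  have hright : ∀ t ≥ 1 / 2, θ t = γ₂ (max 0 (2 * t - 1)) := fun t ht => by
    simp only [hθ]
    rw [max_eq_left (by linarith : 1 - 2 * t ≤ 0), h₁0, add_sub_cancel_left]
  have hnear : ∀ γ : ℝ → Euc n, LipschitzWith (ν / 4) γ → γ 0 = x → ∀ τ, 0 ≤ τ → τ ≤ 1 →
      dist (γ τ) x ≤ ν := by
    intro γ hγ h0 τ hτ0 hτ1
    have := hγ.dist_le_mul τ 0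
    rw [h0, Real.dist_eq, sub_zero, abs_of_nonneg hτ0] at this
    refine this.trans ?_
    push_cast
    have hν' : (0:ℝ) < ν := hν
    nlinarith
  refine ⟨θ, ?_, fun t => ?_, ?_, ?_, fun t ht => ?_⟩
  · have := ((hl₁.comp hp₁).add (hl₂.comp hp₂)).sub (LipschitzWith.const x)
    refine this.weaken (le_of_eq ?_)
    rw [add_zero, ← mul_two, mul_assoc, show (2:ℝ≥0) * 2 = 4 by norm_num,
      div_mul_cancel₀ _ (by norm_num)]
  · rcases le_total t (1 / 2) with ht | ht
    · rw [hleft t ht]; exact hm₁ _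
    · rw [hright t ht]; exact hm₂ _
  · rw [hleft 0 (by norm_num)]; simpa using h₁1
  · rw [hright 1 (by norm_num)]
    norm_num [h₂1]
  · rcases le_total t (1 / 2) with h | h
    · rw [hleft t h]
      exact hnear γ₁ hl₁ h₁0 _ (le_max_left _ _) (max_le zero_le_one (by linarith [ht.1]))
    · rw [hright t h]
      exact hnear γ₂ hl₂ h₂0 _ (le_max_left _ _) (max_le zero_le_one (by linarith [ht.2]))

lemma GeoAssumpE.exists_geoActSet_lt (hD : IsOpen D) (hED : Eset ⊆ D)
    (hℓcont : ContinuousOn (fun p : Euc n × Euc n => ℓ p.1 p.2) (D ×ˢ univ))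
    (hℓnonneg : ∀ x ∈ D, ∀ y : Euc n, 0 ≤ ℓ x y)
    (hℓhom : ∀ x ∈ D, ∀ y : Euc n, ∀ c : ℝ, 0 ≤ c → ℓ x (c • y) = c * ℓ x y)
    (hE : GeoAssumpE Eset) {x : Euc n} (hx : x ∈ Eset) {ε : ℝ} (hε : 0 < ε) :
    ∃ r > 0, ∀ x₁ ∈ Metric.closedBall x r ∩ Eset, ∀ x₂ ∈ Metric.closedBall x r ∩ Eset,
      ∃ s ∈ geoActSet ℓ Eset {x₁} {x₂}, s < ε := by
  obtain ⟨ρ, hρ, hρD⟩ := Metric.nhds_basis_closedBall.mem_iff.1 (hD.mem_nhds (hED hx))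
  obtain ⟨B, hB0, hB⟩ := exists_localAction_le hℓcont hℓhom (isCompact_closedBall x ρ) hρD
  set ν : ℝ≥0 := (min ρ (ε / (B + 1))).toNNReal with hν
  have hmin : 0 < min ρ (ε / (B + 1)) := lt_min hρ (by positivity)
  have hνval : (ν : ℝ) = min ρ (ε / (B + 1)) := Real.coe_toNNReal _ hmin.le
  obtain ⟨r, hr, h⟩ := hE.exists_lipschitzWith_joining hx (Real.toNNReal_pos.2 hmin)
  refine ⟨r, hr, fun x₁ hx₁ x₂ hx₂ => ?_⟩
  obtain ⟨θ, hlip, hmem, h0, h1, hdist⟩ := h x₁ hx₁ x₂ hx₂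
  have hAC := GeoAC.of_lipschitzWith hlip
  refine ⟨_, ⟨θ, deriv θ, hAC, fun t _ => hmem t, h0, h1, rfl⟩, ?_⟩
  have m0 : (0:ℝ) ∈ Icc (0:ℝ) 1 := by simp
  have m1 : (1:ℝ) ∈ Icc (0:ℝ) 1 := by simp
  calc geoAction ℓ θ (deriv θ) ≤ ∫ t in (0:ℝ)..1, B * ‖deriv θ t‖ := by
        refine intervalIntegral.integral_mono_on zero_le_one
          (hAC.intervalIntegrable_localAction hD hℓcont hℓnonneg hℓhom
            (fun t _ => hED (hmem t)) m0 m1)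
          ((hAC.intervalIntegrable m0 m1).norm.const_mul B) fun t ht => hB _ ?_ _
        exact (hdist t ht).trans (hνval.le.trans (min_le_left _ _))
    _ = B * geoLen (deriv θ) := intervalIntegral.integral_const_mul _ _
    _ ≤ B * (ε / (B + 1)) := by
        gcongr
        exact (geoLen_deriv_le_of_lipschitzWith hlip).trans (hνval.le.trans (min_le_right _ _))
    _ < ε := by
        rw [mul_div_assoc', div_lt_iff₀ (by positivity)]
        nlinarith

end Competitors

/-- every point of `E` lying on a flowline emanating from an
admissible manifold of a drift of `ℓ` has strong local minimizers. -/
theorem statement15 {n : ℕ} (D : Set (Euc n)) (hD : IsOpen D) (hDne : D.Nonempty)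
    (Eset : Set (Euc n)) (hEsub : Eset ⊆ D)
    (hEclosed : ∀ w ∈ D, w ∈ closure Eset → w ∈ Eset)
    (hAssumpE : GeoAssumpE Eset)
    (ℓ : Euc n → Euc n → ℝ)
    (hℓcont : ContinuousOn (fun p : Euc n × Euc n => ℓ p.1 p.2) (D ×ˢ Set.univ))
    (hℓnonneg : ∀ x ∈ D, ∀ y : Euc n, 0 ≤ ℓ x y)
    (hℓhom : ∀ x ∈ D, ∀ y : Euc n, ∀ c : ℝ, 0 ≤ c → ℓ x (c • y) = c * ℓ x y)
    (hℓconv : ∀ x ∈ D, ConvexOn ℝ Set.univ (fun y => ℓ x y))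
    (b : Euc n → Euc n) (hb : ContDiffOn ℝ 1 b D)
    (hdrift : ∀ K ⊆ D, IsCompact K → ∃ A > (0:ℝ), ∀ x ∈ K, ∀ y : Euc n,
      A * (‖b x‖ * ‖y‖ - ⟪b x, y⟫) ≤ ℓ x y)
    (ψ : Euc n → ℝ → Euc n) (hψ : GeoIsFlow D b ψ)
    (M : Set (Euc n)) (hM : GeoIsAdmissible D b M)
    (x : Euc n) (hx : x ∈ Eset) (hxM : ∃ m ∈ M, ∃ s : ℝ, ψ m s = x) :
    GeoHasStrongLocalMin ℓ Eset x := by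
  obtain ⟨m, hm, s, rfl⟩ := hxM
  obtain ⟨h, a, R, ha, hR, hRD, hhl, hha, hhx, hhR, κ, hκ, C, hC, htr⟩ :=
    exists_localizing_function hD hℓnonneg hb hdrift hψ hM hm s
  set x := ψ m s
  have hxD := hEsub hx
  obtain ⟨r₁, hr₁, hnear⟩ : ∃ r₁ > 0, ∀ w ∈ Metric.closedBall x r₁, |h w| < a / 2 := by
    have hc : ContinuousAt h x := hhl.continuousOn.continuousAt (hD.mem_nhds hxD)
    have : ∀ᶠ w in 𝓝 x, |h w| < a / 2 :=
      hc.abs.eventually_lt continuousAt_const (by rw [hhx, abs_zero]; positivity)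
    exact Metric.nhds_basis_closedBall.eventually_iff.1 this
  set ε := a / (2 * (C + 1)) with hε
  obtain ⟨r₂, hr₂, hsmall⟩ := hAssumpE.exists_geoActSet_lt hD hEsub hℓcont hℓnonneg hℓhom hx
    (show 0 < ε by positivity)
  have hCε : C * ε ≤ a / 2 := by
    rw [hε, mul_div_assoc', div_le_div_iff₀ (by positivity) two_pos]
    nlinarith
  have hK : IsCompact (R ∩ Eset) := by
    have : R ∩ Eset = R ∩ closure Eset :=
      subset_antisymm (inter_subset_inter_right _ subset_closure)
        fun w hw => ⟨hw.1, hEclosed w (hRD hw.1) hw.2⟩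
    rw [this]
    exact hR.inter_right isClosed_closure
  set η : ℝ≥0 := (2 * a / κ + 1).toNNReal with hη
  have hηval : (η : ℝ) = 2 * a / κ + 1 := Real.coe_toNNReal _ (by positivity)
  refine ⟨min r₁ r₂, lt_min hr₁ hr₂, η, by rw [hηval]; positivity, R ∩ Eset, hK,
    inter_subset_right, fun x₁ hx₁ x₂ hx₂ => ?_⟩
  have hsub₁ := Metric.closedBall_subset_closedBall (x := x) (min_le_left r₁ r₂)
  have hsub₂ := Metric.closedBall_subset_closedBall (x := x) (min_le_right r₁ r₂)
  obtain ⟨s₀, hs₀, hs₀ε⟩ := hsmall x₁ ⟨hsub₂ hx₁.1, hx₁.2⟩ x₂ ⟨hsub₂ hx₂.1, hx₂.2⟩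
  have hbdd : BddBelow (geoActSet ℓ Eset {x₁} {x₂}) := by
    refine ⟨0, ?_⟩
    rintro _ ⟨φ, φ', -, hφ, -, -, rfl⟩
    exact intervalIntegral.integral_nonneg zero_le_one fun t ht =>
      hℓnonneg _ (hEsub (hφ t ht)) _
  obtain ⟨u, -, hu, humem⟩ := exists_seq_tendsto_sInf ⟨s₀, hs₀⟩ hbdd
  obtain ⟨N, hN⟩ := eventually_atTop.1
    (hu.eventually_lt_const ((csInf_le hbdd hs₀).trans_lt hs₀ε))
  choose φ φ' hAC hφE hφ0 hφ1 hφu using fun k => humem (k + N)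
  have hconf : ∀ k, (∀ t ∈ Icc (0:ℝ) 1, |h (φ k t)| < a) ∧ κ * geoLen (φ' k) ≤ 2 * a := by
    intro k
    have hS : C * geoAction ℓ (φ k) (φ' k) ≤ a / 2 := by
      rw [← hφu k]
      exact (mul_le_mul_of_nonneg_left (hN _ le_add_self).le hC).trans hCε
    have e₁ := hnear x₁ (hsub₁ hx₁.1)
    have e₂ := hnear x₂ (hsub₁ hx₂.1)
    refine (hAC k).confined hD hℓcont hℓnonneg hℓhom hhl hha hκ.le hC htr
      (fun t ht => hEsub (hφE k t ht)) ?_ ?_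
    · rw [hφ0 k]; linarith
    · rw [hφ1 k]; linarith
  obtain ⟨θ, θ', hθ, hθK, hθ0, hθ1, hθlen, hθS⟩ := exists_limit_curve hD hℓcont hℓnonneg hℓhom
    hℓconv hK (inter_subset_left.trans hRD) (η := η) hAC
    (fun k t ht => ⟨hhR _ (hEsub (hφE k t ht)) ((hconf k).1 t ht), hφE k t ht⟩) hφ0 hφ1
    (fun k => by
      rw [hηval]
      have := (le_div_iff₀' hκ).2 (hconf k).2
      linarith)
    (((tendsto_add_atTop_iff_nat N).2 hu).congr hφu)
  exact ⟨θ, θ', hθ, hθK, hθ0, hθ1, hθlen, le_antisymm hθS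
    (csInf_le hbdd ⟨θ, θ', hθ, fun t ht => (hθK t ht).2, hθ0, hθ1, rfl⟩)⟩
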